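/- arXiv:2604.24650 — 2 statements merged into one kernel-verified Lean document; each statement's English description precedes it below -/
import Mathlib

section
/- Let k ≥ 3 and 1 < a < b < c be integers with a^k < b < c. Then there exists no k-th power Diophantine triple of the form {a^k, b, c}; that is, it is impossible that a^k·b + 1, a^k·c + 1 and b·c + 1 are all perfect k-th powers. -/
open Polynomial in
/-- Repeated integration by parts. -/
noncomputable def hermS (f : ℕ → ℝ → ℝ) : ℕ → ℝ[X] → ℝ → ℝ
  | 0, _, _ => 0
  | n + 1, φ, v => φ.eval v * f n v - hermS f n (derivative φ) v

open Polynomial in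
lemma hermS_deriv (f : ℕ → ℝ → ℝ) (v : ℝ) (hf : ∀ j, HasDerivAt (f j) (f (j + 1) v) v)
    (n : ℕ) : ∀ φ : ℝ[X], HasDerivAt (hermS f n φ)
      (φ.eval v * f n v - (-1) ^ n * (derivative^[n] φ).eval v * f 0 v) v := by
  induction n with
  | zero =>
    intro φ
    have : hermS f 0 φ = fun _ => 0 := by funext; rfl
    rw [this]
    simpa using hasDerivAt_const v (0 : ℝ)
  | succ n ih =>
    intro φ
    have : hermS f (n + 1) φ = fun v => φ.eval v * f n v - hermS f n (derivative φ) v := by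
      funext; rfl
    rw [this]
    have h := ((φ.hasDerivAt v).mul (hf n)).sub (ih (derivative φ))
    refine HasDerivAt.congr_deriv h ?_
    rw [Function.iterate_succ_apply]
    ring

open Polynomial in
lemma hermS_sum (f : ℕ → ℝ → ℝ) (v : ℝ) (n : ℕ) : ∀ φ : ℝ[X], hermS f n φ v =
    ∑ j ∈ Finset.range n, (-1) ^ (n - 1 - j) * (derivative^[n - 1 - j] φ).eval v * f j v := by
  induction n with
  | zero => intro φ; simp [hermS]
  | succ n ih =>
    intro φ
    rw [hermS, ih, Finset.sum_range_succ]
    simp only [Nat.add_sub_cancel, Nat.sub_self, pow_zero, Function.iterate_zero, id, one_mul]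
    rw [add_comm, sub_eq_add_neg, ← Finset.sum_neg_distrib]
    congr 1
    refine Finset.sum_congr rfl fun j hj => ?_
    have hj := Finset.mem_range.1 hj
    obtain ⟨m, rfl⟩ : ∃ m, n = j + 1 + m := ⟨n - (j + 1), by omega⟩
    have e1 : j + 1 + m - 1 - j = m := by omega
    have e2 : j + 1 + m - j = m + 1 := by omega
    rw [e1, e2, Function.iterate_succ_apply]
    ring

open Polynomial in
lemma iter_deriv_eval (φ : ℝ[X]) (n : ℕ) (v : ℝ) :
    (derivative^[n] φ).eval v = n.factorial * (taylor v φ).coeff n := by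
  rw [taylor_coeff, ← factorial_smul_hasseDeriv]
  simp

open Polynomial in
noncomputable def phiP (r : ℕ) (M N : ℝ) : ℝ[X] := (C N - X) ^ r * (X - C M) ^ r

open Polynomial in
lemma phi_N (r : ℕ) (M N : ℝ) (h : N = M + 1) :
    taylor N (phiP r M N) = C ((-1) ^ r) * (X ^ r * (X + 1) ^ r) := by
  have e1 : taylor N (C N - X) = C (-1) * X := by
    simp [taylor_X]
  have e2 : taylor N (X - C M) = X + 1 := by
    rw [map_sub, taylor_X, taylor_C, h]; simp only [map_add, map_one]; ring
  rw [phiP, taylor_mul, taylor_pow, taylor_pow, e1, e2, mul_pow, C_pow]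
  ring

open Polynomial in
lemma phi_M (r : ℕ) (M N : ℝ) (h : N = M + 1) :
    taylor M (phiP r M N) = C ((-1) ^ r) * (X ^ r * (X + C (-1)) ^ r) := by
  have e1 : taylor M (C N - X) = C (-1) * (X + C (-1)) := by
    rw [map_sub, taylor_X, taylor_C, h]; simp only [map_add, map_one, map_neg]; ring
  have e2 : taylor M (X - C M) = X := by
    rw [map_sub, taylor_X, taylor_C]; ring
  rw [phiP, taylor_mul, taylor_pow, taylor_pow, e1, e2, mul_pow, C_pow]
  ring

open Polynomial in
lemma dN (r : ℕ) (M N : ℝ) (h : N = M + 1) (j : ℕ) (hj : j ≤ r) :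
    (derivative^[2 * r - j] (phiP r M N)).eval N =
      (-1) ^ r * ((2 * r - j).factorial * r.choose j) := by
  rw [iter_deriv_eval, phi_N r M N h, coeff_C_mul, coeff_X_pow_mul', if_pos (by omega),
    coeff_X_add_one_pow]
  have : 2 * r - j - r = r - j := by omega
  rw [this, Nat.choose_symm hj]; ring

open Polynomial in
lemma dN0 (r : ℕ) (M N : ℝ) (h : N = M + 1) (j : ℕ) (hj : r < j) (hj2 : j ≤ 2 * r) :
    (derivative^[2 * r - j] (phiP r M N)).eval N = 0 := by
  rw [iter_deriv_eval, phi_N r M N h, coeff_C_mul, coeff_X_pow_mul', if_neg (by omega)]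
  simp

open Polynomial in
lemma dM (r : ℕ) (M N : ℝ) (h : N = M + 1) (j : ℕ) (hj : j ≤ r) :
    (derivative^[2 * r - j] (phiP r M N)).eval M =
      (-1) ^ r * ((-1) ^ j * ((2 * r - j).factorial * r.choose j)) := by
  rw [iter_deriv_eval, phi_M r M N h, coeff_C_mul, coeff_X_pow_mul', if_pos (by omega),
    coeff_X_add_C_pow]
  have : 2 * r - j - r = r - j := by omega
  rw [this, Nat.choose_symm hj]
  have : r - (r - j) = j := by omega
  rw [this]; ring

open Polynomial in
lemma dM0 (r : ℕ) (M N : ℝ) (h : N = M + 1) (j : ℕ) (hj : r < j) (hj2 : j ≤ 2 * r) :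
    (derivative^[2 * r - j] (phiP r M N)).eval M = 0 := by
  rw [iter_deriv_eval, phi_M r M N h, coeff_C_mul, coeff_X_pow_mul', if_neg (by omega)]
  simp

/-- descending product -/
noncomputable def cc (r : ℕ) (ν : ℝ) (j : ℕ) : ℝ := ∏ i ∈ Finset.range j, (r + ν - i)

noncomputable def ff (r : ℕ) (ν : ℝ) (j : ℕ) (v : ℝ) : ℝ := cc r ν j * v ^ ((r : ℝ) + ν - j)

lemma ff_deriv (r : ℕ) (ν v : ℝ) (hv : 0 < v) (j : ℕ) :
    HasDerivAt (ff r ν j) (ff r ν (j + 1) v) v := by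
  have h := (Real.hasDerivAt_rpow_const (x := v) (p := (r : ℝ) + ν - j)
    (Or.inl hv.ne')).const_mul (cc r ν j)
  refine HasDerivAt.congr_deriv h ?_
  rw [ff, cc, cc, Finset.prod_range_succ]
  push_cast
  rw [show (r : ℝ) + ν - (j + 1) = r + ν - j - 1 by ring]
  ring

lemma cc_last (r : ℕ) (ν : ℝ) (h0 : 0 < ν) (h1 : ν < 1) :
    ∃ K : ℝ, cc r ν (2 * r + 1) = (-1) ^ r * K ∧ 0 < K ∧ K ≤ ν * (r.factorial : ℝ) ^ 2 := by
  refine ⟨ν * ∏ i ∈ Finset.range r, (((i : ℝ) + 1) ^ 2 - ν ^ 2), ?_, ?_, ?_⟩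
  · rw [cc, show 2 * r + 1 = (r + 1) + r by ring, Finset.prod_range_add,
      ← Finset.prod_range_reflect, Finset.prod_range_succ']
    have e1 : ∏ k ∈ Finset.range r, ((r : ℝ) + ν - ((r + 1 - 1 - (k + 1) : ℕ) : ℝ))
        = ∏ k ∈ Finset.range r, (ν + (k + 1)) := by
      refine Finset.prod_congr rfl fun k hk => ?_
      have hk := Finset.mem_range.1 hk
      obtain ⟨m, rfl⟩ : ∃ m, r = k + 1 + m := ⟨r - (k + 1), by omega⟩
      rw [show k + 1 + m + 1 - 1 - (k + 1) = m by omega]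
      push_cast; ring
    rw [e1]
    have e2 : ((-1 : ℝ)) ^ r = ∏ i ∈ Finset.range r, (-1 : ℝ) := by simp
    rw [e2, mul_left_comm, ← Finset.prod_mul_distrib, mul_right_comm, ← Finset.prod_mul_distrib]
    simp only [Nat.add_sub_cancel, Nat.sub_zero]
    rw [mul_comm]
    congr 1
    · ring
    · refine Finset.prod_congr rfl fun k hk => ?_
      push_cast; ring
  · refine mul_pos h0 (Finset.prod_pos fun i _ => ?_)
    have : (0 : ℝ) ≤ i := by positivity
    nlinarith
  · refine mul_le_mul_of_nonneg_left ?_ h0.le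
    have : (r.factorial : ℝ) ^ 2 = ∏ i ∈ Finset.range r, ((i : ℝ) + 1) ^ 2 := by
      rw [Finset.prod_pow, ← Finset.prod_range_add_one_eq_factorial]; push_cast; rfl
    rw [this]
    refine Finset.prod_le_prod (fun i _ => ?_) fun i _ => ?_
    · have : (0 : ℝ) ≤ i := by positivity
      nlinarith
    · nlinarith

noncomputable def uu (r : ℕ) (ν : ℝ) (j : ℕ) : ℝ :=
  ((2 * r - j).factorial : ℝ) * (r.choose j) * cc r ν j

lemma rpow_split (r j : ℕ) (hj : j ≤ r) (ν v : ℝ) (hv : 0 < v) :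
    v ^ ((r : ℝ) + ν - j) = v ^ ν * v ^ (r - j) := by
  rw [← Real.rpow_natCast, ← Real.rpow_add hv, Nat.cast_sub hj]; congr 1; ring

lemma hermS_N (r : ℕ) (ν M N : ℝ) (h : N = M + 1) (hM : 0 < M) :
    hermS (ff r ν) (2 * r + 1) (phiP r M N) N =
      (-1) ^ r * (N ^ ν * ∑ j ∈ Finset.range (r + 1), (-1) ^ j * uu r ν j * N ^ (r - j)) := by
  rw [hermS_sum]
  simp only [Nat.add_sub_cancel]
  rw [← Finset.sum_subset (s₁ := Finset.range (r + 1)) (by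
    intro x; simp only [Finset.mem_range]; omega)]
  · rw [Finset.mul_sum, Finset.mul_sum]
    refine Finset.sum_congr rfl fun j hj => ?_
    have hj : j ≤ r := by have := Finset.mem_range.1 hj; omega
    rw [dN r M N h j hj, ff, rpow_split r j hj ν N (by linarith), uu]
    have : ((-1 : ℝ)) ^ (2 * r - j) = (-1) ^ j := by
      rw [neg_one_pow_eq_pow_mod_two, neg_one_pow_eq_pow_mod_two (n := j)]; congr 1; omega
    rw [this]; ring
  · intro j hj hj'
    simp only [Finset.mem_range] at hj hj'
    rw [dN0 r M N h j (by omega) (by omega)]; simp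

lemma hermS_M (r : ℕ) (ν M N : ℝ) (h : N = M + 1) (hM : 0 < M) :
    hermS (ff r ν) (2 * r + 1) (phiP r M N) M =
      (-1) ^ r * (M ^ ν * ∑ j ∈ Finset.range (r + 1), uu r ν j * M ^ (r - j)) := by
  rw [hermS_sum]
  simp only [Nat.add_sub_cancel]
  rw [← Finset.sum_subset (s₁ := Finset.range (r + 1)) (by
    intro x; simp only [Finset.mem_range]; omega)]
  · rw [Finset.mul_sum, Finset.mul_sum]
    refine Finset.sum_congr rfl fun j hj => ?_
    have hj : j ≤ r := by have := Finset.mem_range.1 hj; omega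
    rw [dM r M N h j hj, ff, rpow_split r j hj ν M (by linarith), uu]
    have : ((-1 : ℝ)) ^ (2 * r - j) = (-1) ^ j := by
      rw [neg_one_pow_eq_pow_mod_two, neg_one_pow_eq_pow_mod_two (n := j)]; congr 1; omega
    rw [this]
    have h2 : ((-1 : ℝ)) ^ j * (-1) ^ j = 1 := by rw [← mul_pow]; simp
    linear_combination (-1) ^ r * ((2 * r - j).factorial * (r.choose j) * cc r ν j * M ^ ν *
      M ^ (r - j)) * h2
  · intro j hj hj'
    simp only [Finset.mem_range] at hj hj'
    rw [dM0 r M N h j (by omega) (by omega)]; simp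

lemma pade_real (r : ℕ) (ν M N : ℝ) (h0 : 0 < ν) (h1 : ν < 1) (h : N = M + 1) (hM : 0 < M) :
    0 < N ^ ν * (∑ j ∈ Finset.range (r + 1), (-1) ^ j * uu r ν j * N ^ (r - j)) -
      M ^ ν * ∑ j ∈ Finset.range (r + 1), uu r ν j * M ^ (r - j) ∧
    N ^ ν * (∑ j ∈ Finset.range (r + 1), (-1) ^ j * uu r ν j * N ^ (r - j)) -
      M ^ ν * ∑ j ∈ Finset.range (r + 1), uu r ν j * M ^ (r - j) ≤
      N ^ ν * (ν * (r.factorial : ℝ) ^ 2 / (4 ^ r * M ^ (r + 1))) := by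
  have hD : ∀ v, 0 < v → HasDerivAt (hermS (ff r ν) (2 * r + 1) (phiP r M N))
      ((phiP r M N).eval v * ff r ν (2 * r + 1) v) v := by
    intro v hv
    have := hermS_deriv (ff r ν) v (ff_deriv r ν v hv) (2 * r + 1) (phiP r M N)
    refine this.congr_deriv ?_
    have hz : Polynomial.derivative^[2 * r + 1] (phiP r M N) = 0 := by
      apply Polynomial.iterate_derivative_eq_zero
      have : (phiP r M N).natDegree ≤ r * 1 + r * 1 := by
        unfold phiP
        refine Polynomial.natDegree_mul_le_of_le ?_ ?_ <;>
        refine Polynomial.natDegree_pow_le_of_le _ ?_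
        · compute_degree
        · compute_degree
      omega
    rw [hz]; simp
  obtain ⟨ξ, ⟨hξ1, hξ2⟩, hξ⟩ := exists_hasDerivAt_eq_slope
    (hermS (ff r ν) (2 * r + 1) (phiP r M N))
    (fun v => (phiP r M N).eval v * ff r ν (2 * r + 1) v) (a := M) (b := N) (by linarith)
    (fun v hv => (hD v (by linarith [hv.1])).continuousAt.continuousWithinAt)
    (fun v hv => hD v (by linarith [hv.1]))
  rw [show N - M = 1 by linarith, div_one, hermS_N r ν M N h hM, hermS_M r ν M N h hM,
    ← mul_sub] at hξ
  obtain ⟨K, hK, hK0, hK1⟩ := cc_last r ν h0 h1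
  have h2 : ((-1 : ℝ)) ^ r * (-1) ^ r = 1 := by rw [← mul_pow]; simp
  have hξ0 : 0 < ξ := by linarith
  have hN : 0 < N := by linarith
  set Z := N ^ ν * (∑ j ∈ Finset.range (r + 1), (-1) ^ j * uu r ν j * N ^ (r - j)) -
      M ^ ν * ∑ j ∈ Finset.range (r + 1), uu r ν j * M ^ (r - j) with hZ
  have hexp : ξ ^ ((r : ℝ) + ν - ((2 * r + 1 : ℕ) : ℝ)) = ξ ^ ν * (ξ ^ (r + 1))⁻¹ := by
    rw [← Real.rpow_natCast, ← Real.rpow_neg hξ0.le, ← Real.rpow_add hξ0]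
    congr 1; push_cast; ring
  have key : Z = ((N - ξ) * (ξ - M)) ^ r * K * (ξ ^ ν * (ξ ^ (r + 1))⁻¹) := by
    have : (phiP r M N).eval ξ = ((N - ξ) * (ξ - M)) ^ r := by
      simp [phiP, mul_pow]
    simp only [ff, hK, hexp, this] at hξ
    linear_combination (-(-1) ^ r) * hξ + (((N - ξ) * (ξ - M)) ^ r * K * (ξ ^ ν * (ξ ^ (r + 1))⁻¹) - Z) * h2
  have p1 : 0 < (N - ξ) * (ξ - M) := mul_pos (by linarith) (by linarith)
  have p2 : (N - ξ) * (ξ - M) ≤ 1 / 4 := by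
    subst h; nlinarith [sq_nonneg (ξ - M - 1/2)]
  rw [key]
  refine ⟨by positivity, ?_⟩
  have q1 : ((N - ξ) * (ξ - M)) ^ r ≤ (1 / 4) ^ r := pow_le_pow_left₀ p1.le p2 r
  have q2 : ξ ^ ν ≤ N ^ ν := Real.rpow_le_rpow hξ0.le hξ2.le h0.le
  have q3 : (ξ ^ (r + 1))⁻¹ ≤ (M ^ (r + 1))⁻¹ :=
    inv_anti₀ (by positivity) (pow_le_pow_left₀ hM.le hξ1.le _)
  calc ((N - ξ) * (ξ - M)) ^ r * K * (ξ ^ ν * (ξ ^ (r + 1))⁻¹)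
      ≤ (1 / 4) ^ r * (ν * (r.factorial : ℝ) ^ 2) * (N ^ ν * (M ^ (r + 1))⁻¹) := by
        gcongr
    _ = _ := by rw [div_pow, one_pow]; field_simp

lemma fact_dvd (k m j : ℕ) (hj : 1 ≤ j) (hjm : j ≤ m) :
    j.factorial ∣ k ^ (j - 1) * ∏ i ∈ Finset.range j, (k * (m - i) + 1) := by
  rw [Nat.dvd_iff_prime_pow_dvd_dvd]
  intro p e hp hpe
  by_cases hpk : p ∣ k
  · refine Dvd.dvd.mul_right ?_ _
    have : Fact p.Prime := ⟨hp⟩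
    have h1 : e ≤ padicValNat p j.factorial :=
      (padicValNat_dvd_iff_le (Nat.factorial_ne_zero j)).1 hpe
    have h2 := sub_one_mul_padicValNat_factorial_lt_of_ne_zero p (n := j) (by omega)
    have h3 : padicValNat p j.factorial ≤ (p - 1) * padicValNat p j.factorial :=
      Nat.le_mul_of_pos_left _ (by have := hp.two_le; omega)
    exact (pow_dvd_pow_of_dvd hpk e).trans (pow_dvd_pow k (by omega))
  · refine Dvd.dvd.mul_left ?_ _
    have hc : Nat.Coprime k (p ^ e) :=
      Nat.Coprime.pow_right _ ((Nat.Prime.coprime_iff_not_dvd hp).2 hpk).symm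
    obtain ⟨m', hm'⟩ : ∃ m', k * m' ≡ 1 [MOD p ^ e] := by
      have hz := Nat.exists_mul_mod_eq_one_of_coprime hc
      by_cases h1 : p ^ e = 1
      · exact ⟨0, by rw [h1]; exact Nat.modEq_one⟩
      · have hpos : 0 < p ^ e := pow_pos hp.pos e
        obtain ⟨y, _, hy⟩ := hz (by omega)
        exact ⟨y, by rw [Nat.ModEq, hy, Nat.mod_eq_of_lt (by omega)]⟩
    have hmod : ∏ i ∈ Finset.range j, (k * (m - i) + 1) ≡
        ∏ i ∈ Finset.range j, (k * (m + m' - i)) [MOD p ^ e] := by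
      refine Nat.ModEq.prod fun i hi => ?_
      have hi := Finset.mem_range.1 hi
      rw [show m + m' - i = (m - i) + m' by omega, mul_add]
      exact Nat.ModEq.add_left _ hm'.symm
    rw [hmod.dvd_iff (dvd_refl _), Finset.prod_mul_distrib, ← Nat.descFactorial_eq_prod_range]
    exact (hpe.trans (Nat.factorial_dvd_descFactorial _ _)).mul_left _

def ww (k r j : ℕ) : ℕ := (2 * r - j).choose r *
  ((k ^ (2 * r - 1 - j) * ∏ i ∈ Finset.range j, (k * (r - i) + 1)) / j.factorial)

lemma ww_eq (k r j : ℕ) (hk : 1 ≤ k) (hr : 1 ≤ r) (hj : j ≤ r) :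
    (ww k r j : ℝ) = (k : ℝ) ^ (2 * r - 1) / (r.factorial : ℝ) ^ 2 * uu r (1 / k) j := by
  have hd : j.factorial ∣ k ^ (2 * r - 1 - j) * ∏ i ∈ Finset.range j, (k * (r - i) + 1) := by
    rcases Nat.eq_zero_or_pos j with rfl | hj0
    · simp
    · refine (fact_dvd k r j hj0 hj).trans (mul_dvd_mul_right (pow_dvd_pow k (by omega)) _)
  have hk0 : (k : ℝ) ≠ 0 := by positivity
  rw [ww, Nat.cast_mul, Nat.cast_div hd (by positivity), uu]
  have e1 : ((∏ i ∈ Finset.range j, (k * (r - i) + 1) : ℕ) : ℝ) = k ^ j * cc r (1 / k) j := by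
    have : (k : ℝ) ^ j = ∏ i ∈ Finset.range j, (k : ℝ) := by simp
    rw [cc, this, ← Finset.prod_mul_distrib, Nat.cast_prod]
    refine Finset.prod_congr rfl fun i hi => ?_
    have := Finset.mem_range.1 hi
    rw [Nat.cast_add, Nat.cast_mul, Nat.cast_sub (by omega)]
    field_simp
    push_cast; ring
  have e2 : ((2 * r - j).factorial : ℝ) * r.choose j * j.factorial =
      (2 * r - j).choose r * (r.factorial : ℝ) ^ 2 := by
    have a1 := Nat.choose_mul_factorial_mul_factorial (n := 2 * r - j) (k := r) (by omega)
    have a2 := Nat.choose_mul_factorial_mul_factorial hj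
    rw [show 2 * r - j - r = r - j by omega] at a1
    have : (2 * r - j).factorial * r.choose j * j.factorial =
      (2 * r - j).choose r * r.factorial ^ 2 := by
      rw [← a1, sq]; nth_rewrite 3 [← a2]; ring
    exact_mod_cast this
  rw [Nat.cast_mul, e1, Nat.cast_pow]
  have e3 : (k : ℝ) ^ (2 * r - 1) = k ^ (2 * r - 1 - j) * k ^ j := by
    rw [← pow_add]; congr 1; omega
  rw [e3]
  have : (j.factorial : ℝ) ≠ 0 := by positivity
  have : (r.factorial : ℝ) ≠ 0 := by positivity
  field_simp
  linear_combination (-cc r (1 / k) j) * e2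

lemma centralBinom_half (r : ℕ) (hr : 1 ≤ r) : 2 * r.centralBinom ≤ 4 ^ r := by
  induction r, hr using Nat.le_induction with
  | base => decide
  | succ n hn ih =>
    have := Nat.succ_mul_centralBinom_succ n
    have h2 : (n + 1) * (n + 1).centralBinom ≤ (n + 1) * (4 * n.centralBinom) := by
      rw [this]; nlinarith [Nat.centralBinom_pos n]
    have := Nat.le_of_mul_le_mul_left h2 (by omega)
    rw [pow_succ]; omega

lemma uu_nonneg (r : ℕ) (ν : ℝ) (h0 : 0 < ν) (j : ℕ) (hj : j ≤ r) : 0 < uu r ν j := by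
  unfold uu
  have : 0 < cc r ν j := Finset.prod_pos fun i hi => by
    have : (i : ℝ) ≤ r := by exact_mod_cast (by have := Finset.mem_range.1 hi; omega)
    linarith
  have := Nat.choose_pos hj
  positivity

lemma uu_le (r : ℕ) (hr : 1 ≤ r) (ν : ℝ) (h0 : 0 < ν) (h1 : ν < 1) (j : ℕ) (hj : j ≤ r) :
    uu r ν j ≤ ((2 * r).factorial : ℝ) * r.choose j := by
  have h : cc r ν j ≤ ((2 * r).descFactorial j : ℝ) := by
    rw [Nat.descFactorial_eq_prod_range, cc, Nat.cast_prod]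
    refine Finset.prod_le_prod (fun i hi => ?_) fun i hi => ?_
    · have : (i : ℝ) ≤ r := by exact_mod_cast (by have := Finset.mem_range.1 hi; omega)
      linarith
    · have := Finset.mem_range.1 hi
      rw [Nat.cast_sub (by omega)]
      have : (1 : ℝ) ≤ r := by exact_mod_cast hr
      push_cast; linarith
  have h2 : ((2 * r - j).factorial : ℝ) * (2 * r).descFactorial j = (2 * r).factorial := by
    exact_mod_cast Nat.factorial_mul_descFactorial (n := 2 * r) (k := j) (by omega)
  rw [uu, ← h2]
  calc _ ≤ ((2 * r - j).factorial : ℝ) * (r.choose j) * ((2 * r).descFactorial j : ℝ) := by gcongr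
    _ = _ := by ring

lemma pade_int (k M r : ℕ) (hk : 2 ≤ k) (hM : 1 ≤ M) (hr : 1 ≤ r) : ∃ p q : ℤ, 0 < q ∧
    (q : ℝ) ≤ (k : ℝ) ^ (2 * r - 1) * (4 ^ r / 2) * ((M : ℝ) + 1) ^ r ∧
    0 < ((M : ℝ) + 1) ^ (1 / k : ℝ) * p - (M : ℝ) ^ (1 / k : ℝ) * q ∧
    ((M : ℝ) + 1) ^ (1 / k : ℝ) * p - (M : ℝ) ^ (1 / k : ℝ) * q ≤
      ((M : ℝ) + 1) ^ (1 / k : ℝ) * ((k : ℝ) ^ (2 * r - 2) / (4 ^ r * (M : ℝ) ^ (r + 1))) := by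
  have hk0 : (0 : ℝ) < k := by positivity
  have hν0 : (0 : ℝ) < 1 / k := by positivity
  have hν1 : (1 : ℝ) / k < 1 := by
    rw [div_lt_one hk0]; exact_mod_cast (by omega : 1 < k)
  have hM0 : (0 : ℝ) < M := by positivity
  obtain ⟨g1, g2⟩ := pade_real r (1 / k) M (M + 1) hν0 hν1 rfl hM0
  set F : ℝ := (k : ℝ) ^ (2 * r - 1) / (r.factorial : ℝ) ^ 2 with hF
  have hF0 : 0 < F := by positivity
  have hp : (((∑ j ∈ Finset.range (r + 1), (-1) ^ j * (ww k r j : ℤ) * (M + 1) ^ (r - j) : ℤ)) : ℝ)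
      = F * ∑ j ∈ Finset.range (r + 1), (-1) ^ j * uu r (1 / k) j * ((M : ℝ) + 1) ^ (r - j) := by
    push_cast
    rw [Finset.mul_sum]
    refine Finset.sum_congr rfl fun j hj => ?_
    rw [ww_eq k r j (by omega) hr (by have := Finset.mem_range.1 hj; omega)]
    ring
  have hq : (((∑ j ∈ Finset.range (r + 1), (ww k r j : ℤ) * M ^ (r - j) : ℤ)) : ℝ)
      = F * ∑ j ∈ Finset.range (r + 1), uu r (1 / k) j * (M : ℝ) ^ (r - j) := by
    push_cast
    rw [Finset.mul_sum]
    refine Finset.sum_congr rfl fun j hj => ?_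
    rw [ww_eq k r j (by omega) hr (by have := Finset.mem_range.1 hj; omega)]
    ring
  refine ⟨∑ j ∈ Finset.range (r + 1), (-1) ^ j * (ww k r j : ℤ) * (M + 1) ^ (r - j),
    ∑ j ∈ Finset.range (r + 1), (ww k r j : ℤ) * M ^ (r - j), ?_, ?_, ?_, ?_⟩
  · have : (0 : ℝ) < F * ∑ j ∈ Finset.range (r + 1), uu r (1 / k) j * (M : ℝ) ^ (r - j) := by
      refine mul_pos hF0 (Finset.sum_pos (fun j hj => ?_) ⟨0, by simp⟩)
      have := uu_nonneg r (1 / k) hν0 j (by have := Finset.mem_range.1 hj; omega)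
      positivity
    rw [← hq] at this
    exact_mod_cast this
  · rw [hq]
    have hb : ∑ j ∈ Finset.range (r + 1), uu r (1 / k) j * (M : ℝ) ^ (r - j) ≤
        (2 * r).factorial * ((M : ℝ) + 1) ^ r := by
      rw [add_comm (M : ℝ) 1, add_pow, Finset.mul_sum]
      refine Finset.sum_le_sum fun j hj => ?_
      have := uu_le r hr (1 / k) hν0 hν1 j (by have := Finset.mem_range.1 hj; omega)
      calc _ ≤ ((2 * r).factorial : ℝ) * r.choose j * (M : ℝ) ^ (r - j) := by gcongr
        _ = _ := by rw [one_pow]; ring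
    have hc : ((2 * r).factorial : ℝ) ≤ 4 ^ r / 2 * (r.factorial : ℝ) ^ 2 := by
      have h1 := centralBinom_half r hr
      have h2 := Nat.choose_mul_factorial_mul_factorial (n := 2 * r) (k := r) (by omega)
      rw [← Nat.centralBinom_eq_two_mul_choose, show 2 * r - r = r by omega] at h2
      have h2' : (r.centralBinom : ℝ) * r.factorial * r.factorial = (2 * r).factorial := by
        exact_mod_cast h2
      have h1' : 2 * (r.centralBinom : ℝ) ≤ 4 ^ r := by exact_mod_cast h1
      rw [← h2', mul_assoc, ← sq]
      gcongr; linarith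
    calc F * ∑ j ∈ Finset.range (r + 1), uu r (1 / k) j * (M : ℝ) ^ (r - j)
        ≤ F * (4 ^ r / 2 * (r.factorial : ℝ) ^ 2 * ((M : ℝ) + 1) ^ r) := by
          refine mul_le_mul_of_nonneg_left (hb.trans ?_) hF0.le
          gcongr
      _ = _ := by rw [hF]; field_simp
  · rw [hp, hq]; nlinarith [mul_pos hF0 g1]
  · rw [hp, hq]
    have := mul_le_mul_of_nonneg_left g2 hF0.le
    calc _ = F * (((M : ℝ) + 1) ^ (1 / k : ℝ) * (∑ j ∈ Finset.range (r + 1),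
          (-1) ^ j * uu r (1 / k) j * ((M : ℝ) + 1) ^ (r - j)) -
      (M : ℝ) ^ (1 / k : ℝ) * ∑ j ∈ Finset.range (r + 1), uu r (1 / k) j * (M : ℝ) ^ (r - j)) := by
          ring
      _ ≤ _ := this
      _ = _ := by
        rw [hF, show 2 * r - 1 = (2 * r - 2) + 1 by omega, pow_succ]
        field_simp

lemma pow_bern (k : ℕ) (W d : ℝ) (hW : 0 ≤ W) (hd : 0 ≤ d) :
    W ^ (k + 1) + (k + 1) * W ^ k * d ≤ (W + d) ^ (k + 1) := by
  induction k with
  | zero => simp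
  | succ n ih =>
    rw [pow_succ (W + d) (n + 1)]
    have h1 := mul_le_mul_of_nonneg_right ih (by linarith : 0 ≤ W + d)
    have h2 : 0 ≤ ((n : ℝ) + 1) * W ^ n * d * d := by positivity
    push_cast
    calc _ ≤ (W ^ (n + 1) + (n + 1) * W ^ n * d) * (W + d) := by
          rw [pow_succ W (n + 1), pow_succ W n]; nlinarith
      _ ≤ _ := h1

/-- numeric growth -/
lemma growth (e : ℕ) (k x y M N : ℝ) (hk : 1 ≤ k) (hx : 1 ≤ x) (hy : 0 < y) (hM : 0 < M)
    (hN : 1 ≤ N)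
    (hG0 : k ^ 3 * 4 ^ 2 * N ^ 2 * x * (2 * x) ^ e ≤ 2 * (4 * M ^ 2) ^ e)
    (hR : k ^ 2 * 4 * N * (k ^ 2) ^ e ≤ (4 * M) ^ e)
    (hI0 : k * 4 * N * x ≤ 2 * y ^ e)
    (step : ∀ s : ℕ, k ^ (2 * s + 1) * 4 ^ (s + 1) * N ^ (s + 1) * x ≤ 2 * y ^ e →
      4 ^ (s + 1) * M ^ (s + 2) ≤ 2 * x * k ^ (2 * s) * y) : False := by
  have hG : ∀ s : ℕ, k ^ (2 * s + 3) * 4 ^ (s + 2) * N ^ (s + 2) * x * (2 * x * k ^ (2 * s)) ^ e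
      ≤ 2 * (4 ^ (s + 1) * M ^ (s + 2)) ^ e := by
    intro s
    induction s with
    | zero => simpa using hG0
    | succ s ih =>
      calc k ^ (2 * (s + 1) + 3) * 4 ^ (s + 1 + 2) * N ^ (s + 1 + 2) * x *
            (2 * x * k ^ (2 * (s + 1))) ^ e
          = (k ^ (2 * s + 3) * 4 ^ (s + 2) * N ^ (s + 2) * x * (2 * x * k ^ (2 * s)) ^ e) *
            (k ^ 2 * 4 * N * (k ^ 2) ^ e) := by
            rw [show 2 * x * k ^ (2 * (s + 1)) = (2 * x * k ^ (2 * s)) * k ^ 2 by ring, mul_pow]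
            ring
        _ ≤ (2 * (4 ^ (s + 1) * M ^ (s + 2)) ^ e) * (4 * M) ^ e := by gcongr
        _ = _ := by
            rw [mul_assoc, ← mul_pow]; congr 2; ring
  have hI : ∀ s : ℕ, k ^ (2 * s + 1) * 4 ^ (s + 1) * N ^ (s + 1) * x ≤ 2 * y ^ e := by
    intro s
    induction s with
    | zero => simpa using hI0
    | succ s ih =>
      have h1 := step s ih
      have hpos : 0 < (2 * x * k ^ (2 * s)) ^ e := by positivity
      refine le_of_mul_le_mul_right ?_ hpos
      calc k ^ (2 * (s + 1) + 1) * 4 ^ (s + 1 + 1) * N ^ (s + 1 + 1) * x * (2 * x * k ^ (2 * s)) ^ e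
          ≤ 2 * (4 ^ (s + 1) * M ^ (s + 2)) ^ e := hG s
        _ ≤ 2 * (2 * x * k ^ (2 * s) * y) ^ e := by gcongr
        _ = _ := by rw [mul_pow]; ring
  obtain ⟨n, hn⟩ := pow_unbounded_of_one_lt (2 * y ^ e) (by norm_num : (1 : ℝ) < 4)
  have h1 := hI n
  have h2 : (4 : ℝ) ^ n ≤ k ^ (2 * n + 1) * 4 ^ (n + 1) * N ^ (n + 1) * x := by
    have a1 : 1 ≤ k ^ (2 * n + 1) := one_le_pow₀ hk
    have a2 : 1 ≤ N ^ (n + 1) := one_le_pow₀ hN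
    calc (4 : ℝ) ^ n ≤ 4 ^ (n + 1) := pow_le_pow_right₀ (by norm_num) (by omega)
      _ = 1 * 4 ^ (n + 1) * 1 * 1 := by ring
      _ ≤ _ := by gcongr
  linarith

lemma four_le_pow (k : ℕ) (hk : 4 ≤ k) : k ^ 4 + 1 ≤ 5 ^ k := by
  induction k, hk using Nat.le_induction with
  | base => norm_num
  | succ n hn ih =>
    rw [pow_succ 5]
    nlinarith [pow_pos (by omega : 0 < n) 2, pow_pos (by omega : 0 < n) 3, mul_le_mul hn hn (by omega) (by omega),
      Nat.mul_le_mul_left (n ^ 3) hn, Nat.mul_le_mul_left (n ^ 2) hn]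

set_option maxHeartbeats 1600000 in
lemma core (k : ℕ) (a b x y z : ℤ) (hk : 3 ≤ k) (hx : 5 ≤ x) (hx3 : k = 3 → 9 ≤ x)
    (hxy : x < y) (ha : 0 < a) (hz : 0 < z) (hab : a ^ k < b)
    (h1 : a ^ k * b + 1 = x ^ k)
    (h2 : (a ^ 2 * z) ^ k + (x ^ k - 1 - (a ^ k) ^ 2) = (x ^ k - 1) * y ^ k) : False := by
  have hak : 0 < a ^ k := pow_pos ha k
  obtain ⟨m, hm⟩ : ∃ m : ℕ, (m : ℤ) = a ^ k * b :=
    ⟨(a ^ k * b).toNat, Int.toNat_of_nonneg (by nlinarith)⟩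
  obtain ⟨l, rfl⟩ : ∃ l, k = l + 1 := ⟨k - 1, by omega⟩
  set k := l + 1 with hkdef
  have hk0 : k ≠ 0 := by omega
  have hxkZ : (m : ℤ) + 1 = x ^ k := by rw [hm, h1]
  set X : ℝ := (x : ℝ) with hX
  set Y : ℝ := (y : ℝ) with hY
  set M : ℝ := (m : ℝ) with hM
  set W : ℝ := ((a ^ 2 * z : ℤ) : ℝ) with hW
  have hXk : M + 1 = X ^ k := by rw [hM, hX]; exact_mod_cast hxkZ
  have hX5 : (5 : ℝ) ≤ X := by rw [hX]; exact_mod_cast hx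
  have hXY : X + 1 ≤ Y := by rw [hX, hY]; exact_mod_cast hxy
  have hY0 : 0 < Y := by linarith
  have hW0 : 0 < W := by rw [hW]; exact_mod_cast (by positivity)
  have hdel0 : (0 : ℝ) < M - ((a ^ k) ^ 2 : ℤ) := by
    have : (a ^ k) ^ 2 < (m : ℤ) := by rw [hm]; nlinarith
    have : (((a ^ k) ^ 2 : ℤ) : ℝ) < ((m : ℤ) : ℝ) := by exact_mod_cast this
    rw [hM]; push_cast at this ⊢; linarith
  have hdel1 : M - ((a ^ k) ^ 2 : ℤ) ≤ X ^ k := by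
    have : (0 : ℝ) ≤ ((a ^ k) ^ 2 : ℤ) := by exact_mod_cast (by positivity)
    linarith
  set δ : ℝ := M - ((a ^ k) ^ 2 : ℤ) with hδ
  have hWk : W ^ k + δ = M * Y ^ k := by
    have : ((a ^ 2 * z) ^ k + ((m : ℤ) - (a ^ k) ^ 2)) = (m : ℤ) * y ^ k := by
      rw [show (m : ℤ) = x ^ k - 1 by linarith, ← h2]
    rw [hW, hδ, hM, hY]; exact_mod_cast this
  have hM5 : (5 : ℝ) ^ k ≤ M + 1 := by rw [hXk]; gcongr
  have hM1 : (124 : ℝ) ≤ M := by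
    have : (5 : ℝ) ^ 3 ≤ 5 ^ k := pow_le_pow_right₀ (by norm_num) hk
    linarith
  have hMN : 1 ≤ m := by
    have : (1 : ℝ) ≤ m := by linarith
    exact_mod_cast this
  set β : ℝ := M ^ (1 / (k : ℝ)) with hβ
  have hβ0 : 0 < β := by positivity
  have hβk : β ^ k = M := by
    rw [hβ, one_div, Real.rpow_inv_natCast_pow (by linarith) hk0]
  have hXr : (M + 1) ^ (1 / (k : ℝ)) = X := by
    rw [hXk, one_div, Real.pow_rpow_inv_natCast (by linarith) hk0]
  have hβX : β < X := by
    refine lt_of_pow_lt_pow_left₀ k (by linarith) ?_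
    rw [hβk, ← hXk]; linarith
  have hkR : (3 : ℝ) ≤ l + 1 := by exact_mod_cast hk
  -- the difference d
  set d : ℝ := β * Y - W with hd
  have hd0 : 0 < d := by
    have : W < β * Y := by
      refine lt_of_pow_lt_pow_left₀ k (by positivity) ?_
      rw [mul_pow, hβk, ← hWk]; linarith
    linarith
  have hd1 : 2 * Y ^ l * d ≤ X := by
    have hb := pow_bern l W d hW0.le hd0.le
    rw [show W + d = β * Y by rw [hd]; ring, mul_pow, hβk, ← hWk] at hb
    have hb2 : (l + 1) * W ^ l * d ≤ X ^ k := by linarith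
    have hWXY : W ≤ X * Y := by
      have : 0 < Y * (X - β) := mul_pos hY0 (by linarith)
      have : X * Y - W = Y * (X - β) + d := by rw [hd]; ring
      linarith
    have hYk : X ^ k ≤ Y ^ k := by gcongr; linarith
    have hc : 2 * (X * Y) ^ l ≤ (l + 1) * W ^ l := by
      have t1 : W ^ k ≤ W ^ l * (X * Y) := by
        rw [hkdef, pow_succ]; gcongr
      have t2 : 2 * (X * Y) ^ k ≤ 3 * W ^ k := by
        rw [mul_pow]; nlinarith
      have t3 : 2 * (X * Y) ^ l * (X * Y) ≤ 3 * W ^ l * (X * Y) := by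
        rw [mul_assoc 2, ← pow_succ]; linarith
      have t4 := le_of_mul_le_mul_right t3 (by nlinarith)
      have : 0 < W ^ l := by positivity
      nlinarith
    have : 2 * (X * Y) ^ l * d ≤ X ^ k := (mul_le_mul_of_nonneg_right hc hd0.le).trans hb2
    rw [mul_pow, hkdef, pow_succ] at this
    have hp : 0 < X ^ l := by positivity
    refine le_of_mul_le_mul_left ?_ hp
    linarith
  -- r = 0
  have hr0 : 11 * ((l + 1) * M) ≤ 12 * (X * Y) := by
    have hb := pow_bern l β (X - β) hβ0.le (by linarith)
    rw [show β + (X - β) = X by ring, ← hXk, hβk] at hb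
    have hb1 : (l + 1) * β ^ l * (X - β) ≤ 1 := by linarith
    have hb2 : M ≤ β ^ l * X := by
      rw [← hβk, hkdef, pow_succ]; gcongr
    have hb3 : (l + 1) * M * (X - β) ≤ X := by
      calc (l + 1) * M * (X - β) ≤ (l + 1) * (β ^ l * X) * (X - β) := by
            have : 0 ≤ X - β := by linarith
            gcongr
        _ = X * ((l + 1) * β ^ l * (X - β)) := by ring
        _ ≤ X * 1 := by gcongr
        _ = X := by ring
    have hi : (1 : ℝ) ≤ X * Y - W := by
      have h0 : (0 : ℝ) < X * Y - W := by
        have : 0 < Y * (X - β) := mul_pos hY0 (by linarith)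
        have : X * Y - W = Y * (X - β) + d := by rw [hd]; ring
        linarith
      have h0' : (0 : ℤ) < x * y - a ^ 2 * z := by
        rw [hX, hY, hW] at h0; exact_mod_cast h0
      rw [hX, hY, hW]; exact_mod_cast (by omega : (1 : ℤ) ≤ x * y - a ^ 2 * z)
    have hd2 : 12 * d ≤ 1 := by
      have : Y ^ 2 ≤ Y ^ l := pow_le_pow_right₀ (by linarith) (by omega)
      have : 2 * Y ^ 2 * d ≤ X := le_trans (by gcongr) hd1
      by_contra hcon
      push Not at hcon
      nlinarith [mul_pos hd0 (by linarith : 0 < Y)]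
    have hi2 : 11 ≤ 12 * (Y * (X - β)) := by
      have : X * Y - W = Y * (X - β) + d := by rw [hd]; ring
      linarith
    have hpos : 0 < (l + 1) * M := by positivity
    calc 11 * ((l + 1) * M) ≤ 12 * (Y * (X - β)) * ((l + 1) * M) := by gcongr
      _ = 12 * Y * ((l + 1) * M * (X - β)) := by ring
      _ ≤ 12 * Y * X := by
        have : 0 ≤ Y := by linarith
        gcongr
      _ = _ := by ring
  have hstep : ∀ e : ℕ, e ≤ l → ∀ s : ℕ,
      (k : ℝ) ^ (2 * s + 1) * 4 ^ (s + 1) * (M + 1) ^ (s + 1) * X ≤ 2 * Y ^ e →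
      4 ^ (s + 1) * M ^ (s + 2) ≤ 2 * X * (k : ℝ) ^ (2 * s) * Y := by
    intro e he s hs
    obtain ⟨p, q, hq0, hq1, hpq0, hpq1⟩ := pade_int k m (s + 1) (by omega) hMN (by omega)
    rw [← hM, hXr, ← hβ] at hpq0 hpq1
    rw [show 2 * (s + 1) - 2 = 2 * s by omega] at hpq1
    rw [show 2 * (s + 1) - 1 = 2 * s + 1 by omega, ← hM] at hq1
    have hqR : (0 : ℝ) < q := by exact_mod_cast hq0
    have hΛ : (p : ℝ) * X * Y - q * W = Y * (X * p - β * q) + q * d := by rw [hd]; ring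
    have hi : (1 : ℝ) ≤ (p : ℝ) * X * Y - q * W := by
      have h0 : (0 : ℝ) < (p : ℝ) * X * Y - q * W := by rw [hΛ]; positivity
      have h0' : (0 : ℤ) < p * x * y - q * (a ^ 2 * z) := by
        rw [hX, hY, hW] at h0; exact_mod_cast h0
      rw [hX, hY, hW]; exact_mod_cast (by omega : (1 : ℤ) ≤ p * x * y - q * (a ^ 2 * z))
    have hqd : 2 * (q * d) ≤ 1 := by
      have hYe : Y ^ e ≤ Y ^ l := pow_le_pow_right₀ (by linarith) he
      have hYl : 0 < Y ^ l := by positivity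
      have e1 : (q : ℝ) * X ≤ Y ^ l := by
        calc (q : ℝ) * X ≤ (k : ℝ) ^ (2 * s + 1) * (4 ^ (s + 1) / 2) * (M + 1) ^ (s + 1) * X := by
              gcongr
          _ = ((k : ℝ) ^ (2 * s + 1) * 4 ^ (s + 1) * (M + 1) ^ (s + 1) * X) / 2 := by ring
          _ ≤ Y ^ l := by linarith
      have e2 : q * (2 * Y ^ l * d) ≤ q * X := by gcongr
      refine le_of_mul_le_mul_left ?_ hYl
      linarith
    have hfin : 1 ≤ 2 * (Y * (X * ((k : ℝ) ^ (2 * s) / (4 ^ (s + 1) * M ^ (s + 1 + 1))))) := by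
      have : Y * (X * p - β * q) ≤ Y * (X * ((k : ℝ) ^ (2 * s) / (4 ^ (s + 1) * M ^ (s + 1 + 1)))) := by
        gcongr
      linarith
    have hpos : 0 < 4 ^ (s + 1) * M ^ (s + 2) := by positivity
    have : 2 * (Y * (X * ((k : ℝ) ^ (2 * s) / (4 ^ (s + 1) * M ^ (s + 1 + 1))))) =
        (2 * X * (k : ℝ) ^ (2 * s) * Y) / (4 ^ (s + 1) * M ^ (s + 2)) := by ring
    rw [this, le_div_iff₀ hpos] at hfin
    linarith
  have hkc : (k : ℝ) = l + 1 := by rw [hkdef]; push_cast; ring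
  by_cases hk3 : k = 3
  · have hl : l = 2 := by omega
    have hX9 : (9 : ℝ) ≤ X := by rw [hX]; exact_mod_cast hx3 hk3
    have hN : M + 1 = X ^ 3 := by rw [hXk, hk3]
    have hM7 : 728 ≤ M := by
      have : (9 : ℝ) ^ 3 ≤ X ^ 3 := by gcongr
      linarith
    have hkk : (k : ℝ) = 3 := by rw [hk3]; norm_num
    refine growth 2 k X Y M (M + 1) (by rw [hkk]; norm_num) (by linarith) (by linarith)
      (by linarith) (by linarith) ?_ ?_ ?_ (hstep 2 (by omega))
    · rw [hkk]
      have : (3 : ℝ) ^ 3 * 4 ^ 2 * (M + 1) ^ 2 * X * (2 * X) ^ 2 = 1728 * (M + 1) ^ 3 := by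
        rw [pow_succ (M + 1) 2]; nth_rewrite 3 [hN]; ring
      rw [this]
      have h3 : (M + 1) ^ 3 ≤ (2 * M) ^ 3 := by gcongr; linarith
      have h4 : 0 < M ^ 3 := by positivity
      nlinarith
    · rw [hkk]; nlinarith
    · rw [hkk]
      have h3 : 11 * (3 * M) ≤ 12 * (X * Y) := by
        rw [← hkc, hkk] at hr0; exact hr0
      have h4 : (11 * (3 * M)) ^ 2 ≤ (12 * (X * Y)) ^ 2 := by gcongr
      have hX2 : 0 < X ^ 2 := by positivity
      refine le_of_mul_le_mul_left ?_ hX2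
      have : X ^ 2 * (3 * 4 * (M + 1) * X) = 12 * (M + 1) ^ 2 := by
        rw [sq (M + 1)]; nth_rewrite 3 [hN]; ring
      rw [this]
      nlinarith
  · have hk4 : 4 ≤ k := by omega
    have hkM : (k : ℝ) ^ 4 ≤ M := by
      have : (k : ℝ) ^ 4 + 1 ≤ 5 ^ k := by exact_mod_cast four_le_pow k hk4
      linarith
    have hk4R : (4 : ℝ) ≤ k := by exact_mod_cast hk4
    have hX4 : X ^ 4 ≤ M + 1 := by
      rw [hXk]; exact pow_le_pow_right₀ (by linarith) hk4
    have hN2 : M + 1 ≤ 2 * M := by linarith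
    refine growth 3 k X Y M (M + 1) (by linarith) (by linarith) (by linarith)
      (by linarith) (by linarith) ?_ ?_ ?_ (hstep 3 (by omega))
    · have hk3M : (k : ℝ) ^ 3 ≤ M :=
        le_trans (pow_le_pow_right₀ (by linarith) (by norm_num)) hkM
      calc (k : ℝ) ^ 3 * 4 ^ 2 * (M + 1) ^ 2 * X * (2 * X) ^ 3
          = 128 * ((k : ℝ) ^ 3 * (M + 1) ^ 2 * X ^ 4) := by ring
        _ ≤ 128 * (M * (2 * M) ^ 2 * (2 * M)) := by
          gcongr
          linarith
        _ = 128 * (8 * M ^ 4) := by ring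
        _ ≤ 128 * (M ^ 2 * M ^ 4) := by gcongr; nlinarith
        _ = _ := by ring
    · calc (k : ℝ) ^ 2 * 4 * (M + 1) * ((k : ℝ) ^ 2) ^ 3 = 4 * ((k : ℝ) ^ 4) ^ 2 * (M + 1) := by ring
        _ ≤ 4 * M ^ 2 * (2 * M) := by gcongr
        _ ≤ _ := by
          have : 0 < M ^ 3 := by positivity
          nlinarith
    · have h4 : (11 * (k * M)) ^ 3 ≤ (12 * (X * Y)) ^ 3 := by
        rw [hkc]; gcongr
      have hX3 : 0 < X ^ 3 := by positivity
      refine le_of_mul_le_mul_left ?_ hX3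
      have h5 : X ^ 3 * (2 * Y ^ 3) = 2 / 1728 * (12 * (X * Y)) ^ 3 := by ring
      rw [h5]
      calc X ^ 3 * ((k : ℝ) * 4 * (M + 1) * X) = 4 * k * (M + 1) * X ^ 4 := by ring
        _ ≤ 4 * k * (2 * M) * (2 * M) := by
          gcongr
          linarith
        _ = 16 * k * M ^ 2 := by ring
        _ ≤ k ^ 3 * M ^ 2 := by
          have : 16 * (k : ℝ) ≤ k ^ 3 := by
            have h16 : (4 : ℝ) ^ 2 ≤ (k : ℝ) ^ 2 := by gcongr
            nlinarith [mul_le_mul_of_nonneg_right h16 (by linarith : (0 : ℝ) ≤ k)]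
          gcongr
        _ ≤ 2 / 1728 * (11 * (k * M)) ^ 3 := by
          have : 0 < (k : ℝ) ^ 3 * M ^ 2 := by positivity
          nlinarith
        _ ≤ _ := by gcongr

/-- There are no `k`-th power Diophantine triples of the form `{a^k, b, c}`
for `k ≥ 3` and `1 < a < b < c` with `a^k < b < c`. -/
theorem no_kth_power_diophantine_triple
    (k : ℕ) (a b c : ℤ) (hk : 3 ≤ k)
    (ha : 1 < a) (hab : a < b) (hbc : b < c) (hakb : a ^ k < b) :
    ¬ ∃ r s t : ℤ, 0 < r ∧ 0 < s ∧ 0 < t ∧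
      a ^ k * b + 1 = r ^ k ∧ a ^ k * c + 1 = s ^ k ∧ b * c + 1 = t ^ k := by
  rintro ⟨x, y, z, hx, hy, hz, h1, h2, h3⟩
  have hak : 0 < a ^ k := pow_pos (by omega) k
  have hxa : a ^ 2 < x := by
    refine lt_of_pow_lt_pow_left₀ k hx.le ?_
    rw [← h1, ← pow_mul, mul_comm 2 k, pow_mul]; nlinarith
  have hxy : x < y := by
    refine lt_of_pow_lt_pow_left₀ k hy.le ?_
    rw [← h1, ← h2]; nlinarith
  refine core k a b x y z hk (by nlinarith) ?_ hxy (by omega) hz hakb h1 ?_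
  · rintro rfl
    by_cases h : a = 2
    · subst h
      by_contra hcon
      push Not at hcon
      have : 5 ≤ x := by omega
      interval_cases x <;> omega
    · have : 3 ≤ a := by omega
      nlinarith
  · rw [mul_pow, ← h1, ← h2, ← h3, ← pow_mul, mul_comm 2 k, pow_mul]
    ring
end

section
/- Let p and q be positive integers and let n, N be positive integers with n ≥ 3 such that (√N + √(N+1))^{2(n−2)} > (n·μ_n)^n, where μ_n = Π_{p prime, p ∣ n} p^{1/(p−1)}. Then |(1 + 1/N)^{1/n} − p/q| > (8·n·μ_n·N)^{−1}·q^{−λ}, where λ = 1 + log(n·μ_n·(√N + √(N+1))^2) / log((1/(n·μ_n))·(√N + √(N+1))^2). -/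
open Real

section BennettAux
open Finset

lemma bn_pf (k : ℕ) : ∀ s : ℝ, (∀ b : ℕ, s + b ≠ 0) →
    ∑ b ∈ range (k+1), (-1:ℝ)^b * (k.choose b) / (s + b) = (k.factorial : ℝ) / ∏ b ∈ range (k+1), (s + b) := by
  induction k with
  | zero => intro s hs; simp
  | succ k ih =>
    intro s hs
    have hs' : ∀ b : ℕ, (s+1) + b ≠ 0 := by
      intro b; have := hs (b+1); push_cast at this; intro h; apply this; linarith
    have key : ∑ b ∈ range (k+1+1), (-1:ℝ)^b * ((k+1).choose b) / (s + b)
      = ∑ b ∈ range (k+1), (-1:ℝ)^b * (k.choose b) / (s + b)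
        - ∑ b ∈ range (k+1), (-1:ℝ)^b * (k.choose b) / (s + 1 + b) := by
      have e1 : ∑ b ∈ range (k+1), (-1:ℝ)^b * (k.choose b) / (s + b) = ∑ b ∈ range (k+1+1), (-1:ℝ)^b * (k.choose b) / (s + b) := by
        rw [Finset.sum_range_succ _ (k+1)]; simp
      rw [e1, Finset.sum_range_succ', Finset.sum_range_succ' _ (k+1)]
      have : ∀ b ∈ range (k+1), (-1:ℝ)^(b+1) * ((k+1).choose (b+1)) / (s + (b+1:ℕ)) = 
         (-1:ℝ)^(b+1) * (k.choose (b+1)) / (s + (b+1:ℕ)) - (-1:ℝ)^b * (k.choose b) / (s + 1 + b) := by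
        intro b _
        rw [Nat.choose_succ_succ]
        have := hs (b+1)
        have e : s + 1 + b = s + (b+1:ℕ) := by push_cast; ring
        rw [e]; push_cast; push_cast at this
        field_simp
        ring
      rw [Finset.sum_congr rfl this, Finset.sum_sub_distrib]
      simp
      ring
    rw [key, ih s hs, ih (s+1) hs']
    have p1 : ∏ b ∈ range (k+1), (s + b) = (∏ b ∈ range k, (s + 1 + b)) * s := by
      rw [Finset.prod_range_succ']; simp
      left; apply Finset.prod_congr rfl; intros; ring
    have p2 : ∏ b ∈ range (k+1+1), (s + b) = (∏ b ∈ range k, (s + 1 + b)) * (s + 1 + k) * s := by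
      rw [Finset.prod_range_succ', ← Finset.prod_range_succ]; simp
      left; apply Finset.prod_congr rfl; intros; ring
    have p0 : ∏ b ∈ range k, (s + 1 + b) ≠ 0 := Finset.prod_ne_zero_iff.2 (fun b _ => hs' b)
    rw [p2, p1, Finset.prod_range_succ, Nat.factorial_succ]
    have h0 := hs 0
    have h1 := hs' k
    simp at h0
    push_cast
    field_simp
    ring

noncomputable def bnV (c : ℝ) (j : ℕ) : ℝ := ∏ i ∈ range j, ((i:ℝ) + 1 + c)

lemma bn_choose_prod {R : Type*} [CommRing R] [BinomialRing R] (r : R) (j : ℕ) :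
    (j.factorial : R) * Ring.choose r j = ∏ i ∈ range j, (r - i) := by
  have := Ring.descPochhammer_eq_factorial_smul_choose r j
  rw [nsmul_eq_mul] at this
  rw [← this]
  clear this
  induction j with
  | zero => simp
  | succ j ih =>
    rw [descPochhammer_succ_right, Polynomial.smeval_mul, ih, Finset.prod_range_succ]
    simp [Polynomial.smeval_sub, Polynomial.smeval_natCast]

lemma bn_choose_V (k a : ℕ) (h : a ≤ k) (s : ℝ) :
    (a.factorial : ℝ) * Ring.choose ((k:ℝ) + s) a * bnV s (k-a) = bnV s k := by
  rw [bn_choose_prod]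
  obtain ⟨d, rfl⟩ := Nat.exists_eq_add_of_le h
  rw [Nat.add_sub_cancel_left]
  unfold bnV
  rw [add_comm a d, Finset.prod_range_add, mul_comm]
  congr 1
  rw [← Finset.prod_range_reflect]
  apply Finset.prod_congr rfl
  intro i hi
  have : i + 1 ≤ a := by simpa using hi
  rw [Nat.sub_sub, Nat.cast_sub (by omega)]
  push_cast; ring


noncomputable def bnW (k : ℕ) (s : ℝ) (a : ℕ) : ℝ :=
  Ring.choose ((k:ℝ) - s) (k - a) * Ring.choose ((k:ℝ) + s) a

noncomputable def bnP (k : ℕ) (s x : ℝ) : ℝ := ∑ a ∈ range (k+1), bnW k s a * x ^ a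

noncomputable def bnK (k : ℕ) (s : ℝ) : ℝ := s * bnV s k * bnV (-s) k / (k.factorial : ℝ)^2

lemma bnV_ne (s : ℝ) (hs : ∀ m : ℤ, s + m ≠ 0) (j : ℕ) : bnV s j ≠ 0 := by
  refine Finset.prod_ne_zero_iff.2 (fun b _ => ?_)
  have := hs (b+1)
  push_cast at this
  intro h; apply this; linarith

lemma bnV_ne' (s : ℝ) (hs : ∀ m : ℤ, s + m ≠ 0) (j : ℕ) : bnV (-s) j ≠ 0 := by
  refine Finset.prod_ne_zero_iff.2 (fun b _ => ?_)
  have := hs (-(b+1))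
  push_cast at this
  intro h; apply this; linarith

lemma bn_prod_split (s : ℝ) (k a : ℕ) (h : a ≤ k) :
    ∏ b ∈ range (k+1), (s - a + b) = (-1)^a * bnV (-s) a * s * bnV s (k-a) := by
  obtain ⟨d, rfl⟩ := Nat.exists_eq_add_of_le h
  rw [Nat.add_sub_cancel_left, add_assoc, Finset.prod_range_add, Finset.prod_range_succ']
  unfold bnV
  have h1 : ∏ b ∈ range a, (s - a + b) = (-1)^a * ∏ i ∈ range a, ((i:ℝ) + 1 + -s) := by
    rw [← Finset.prod_range_reflect]
    rw [show (-1:ℝ)^a = ∏ i ∈ range a, (-1:ℝ) by simp, ← Finset.prod_mul_distrib]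
    apply Finset.prod_congr rfl
    intro i hi
    have : i + 1 ≤ a := by simpa using hi
    rw [Nat.sub_sub, Nat.cast_sub (by omega)]
    push_cast; ring
  rw [h1]
  have h2 : ∏ k ∈ range d, (s - a + ((a + (k+1) : ℕ):ℝ)) = ∏ i ∈ range d, ((i:ℝ) + 1 + s) := by
    apply Finset.prod_congr rfl
    intro i hi
    push_cast; ring
  rw [h2]
  push_cast; ring

lemma bn_coef (s : ℝ) (hs : ∀ m : ℤ, s + m ≠ 0) (k a : ℕ) (h : a ≤ k) :
    bnK k s * ((-1)^a * (k.choose a) * ∑ b ∈ range (k+1), (-1:ℝ)^b * (k.choose b) / (s - a + b))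
     = bnW k s a := by
  rw [bn_pf, bn_prod_split s k a h]
  swap
  · intro b hb
    apply hs (b - a); push_cast; linarith
  have h1 := bn_choose_V k a h s
  have h2 := bn_choose_V k (k-a) (Nat.sub_le _ _) (-s)
  rw [Nat.sub_sub_self h, ← sub_eq_add_neg] at h2
  unfold bnK bnW
  rw [← h1, ← h2, Nat.cast_choose ℝ h]
  have := bnV_ne s hs (k-a)
  have := bnV_ne' s hs a
  have : s ≠ 0 := by simpa using hs 0
  have := Nat.factorial_ne_zero k
  have := Nat.factorial_ne_zero a
  have := Nat.factorial_ne_zero (k-a)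
  have e : ((-1:ℝ)^a) * (-1)^a = 1 := by rw [← mul_pow]; simp
  have : (-1:ℝ)^a ≠ 0 := by positivity
  field_simp

noncomputable def bnI (k : ℕ) (s x : ℝ) : ℝ := ∫ t in (1:ℝ)..x, ((x - t) * (t - 1) / t)^k * t ^ (s - 1)

lemma bn_integrand (k : ℕ) (s x t : ℝ) (ht : 0 < t) :
    ((x - t) * (t - 1) / t)^k * t ^ (s - 1) = ∑ a ∈ range (k+1), ∑ b ∈ range (k+1),
      ((-1:ℝ)^a * (k.choose a) * ((-1:ℝ)^b * (k.choose b)) * x ^ a) * t ^ (s + b - a - 1) := by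
  have e1 : (x - t) * (t - 1) / t = (-(x / t) + 1) * (-t + 1) := by field_simp; ring
  rw [e1, mul_pow, add_pow, add_pow, Finset.sum_mul_sum, Finset.sum_mul]
  apply Finset.sum_congr rfl; intro a _
  rw [Finset.sum_mul]
  apply Finset.sum_congr rfl; intro b _
  have : t ^ (s + b - a - 1) = t ^ (s-1) * t ^ b / t ^ a := by
    rw [show s + b - a - 1 = (s - 1) + b - a by ring, Real.rpow_sub ht, Real.rpow_add ht]
    simp
  rw [this, neg_pow (x/t), neg_pow t, div_pow]
  simp only [one_pow]
  field_simp

lemma bn_integral (k : ℕ) (s x : ℝ) (hx : 1 < x) (hs : ∀ m : ℤ, s + m ≠ 0) :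
    bnI k s x = ∑ a ∈ range (k+1), ∑ b ∈ range (k+1),
      ((-1:ℝ)^a * (k.choose a) * ((-1:ℝ)^b * (k.choose b)) * x ^ a) * ((x ^ (s + b - a) - 1) / (s - a + b)) := by
  unfold bnI
  have h0 : (0:ℝ) ∉ Set.uIcc 1 x := by
    rw [Set.uIcc_of_le hx.le]; simp
  rw [intervalIntegral.integral_congr (g := fun t => ∑ a ∈ range (k+1), ∑ b ∈ range (k+1),
      ((-1:ℝ)^a * (k.choose a) * ((-1:ℝ)^b * (k.choose b)) * x ^ a) * t ^ (s + b - a - 1))]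
  swap
  · intro t ht
    rw [Set.uIcc_of_le hx.le] at ht
    exact bn_integrand k s x t (by linarith [ht.1])
  have hi : ∀ r : ℝ, IntervalIntegrable (fun t : ℝ => t ^ r) MeasureTheory.volume 1 x := fun r =>
    intervalIntegral.intervalIntegrable_rpow (Or.inr h0)
  rw [intervalIntegral.integral_finsetSum]
  swap
  · intro a _
    have := IntervalIntegrable.sum (μ := MeasureTheory.volume) (a := 1) (b := x) (range (k+1)) (f := fun b t => 
      ((-1:ℝ)^a * (k.choose a) * ((-1:ℝ)^b * (k.choose b)) * x ^ a) * t ^ (s + b - a - 1))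
      (fun b _ => (hi _).const_mul _)
    have e : (∑ b ∈ range (k+1), fun t : ℝ =>
      ((-1:ℝ)^a * (k.choose a) * ((-1:ℝ)^b * (k.choose b)) * x ^ a) * t ^ (s + b - a - 1)) =
      fun t => ∑ b ∈ range (k+1), 
      ((-1:ℝ)^a * (k.choose a) * ((-1:ℝ)^b * (k.choose b)) * x ^ a) * t ^ (s + b - a - 1) := by
      ext t; simp
    rw [e] at this
    exact this
  apply Finset.sum_congr rfl; intro a _
  rw [intervalIntegral.integral_finsetSum]
  swap
  · intro b _
    exact (hi _).const_mul _
  apply Finset.sum_congr rfl; intro b _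
  rw [intervalIntegral.integral_const_mul, integral_rpow]
  · rw [Real.one_rpow]; congr 2
    · ring_nf
    · ring
  · right
    refine ⟨?_, h0⟩
    intro h
    apply hs (b - a); push_cast; linarith

lemma bn_main_identity (k : ℕ) (s x : ℝ) (hx : 1 < x) (hs : ∀ m : ℤ, s + m ≠ 0) :
    bnK k s * bnI k s x = x ^ s * bnP k (-s) x - bnP k s x := by
  have hs' : ∀ m : ℤ, -s + m ≠ 0 := by
    intro m hm; apply hs (-m); push_cast; linarith
  have hK : bnK k (-s) = - bnK k s := by unfold bnK; rw [neg_neg]; ring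
  have e1 : bnP k s x = bnK k s * ∑ a ∈ range (k+1), ∑ b ∈ range (k+1),
      ((-1:ℝ)^a * (k.choose a) * ((-1:ℝ)^b * (k.choose b)) * x ^ a) * (1 / (s - a + b)) := by
    unfold bnP
    rw [Finset.mul_sum]
    apply Finset.sum_congr rfl; intro a ha
    rw [← bn_coef s hs k a (by simpa [Nat.lt_succ_iff] using ha), mul_assoc]
    simp only [Finset.mul_sum, Finset.sum_mul]
    apply Finset.sum_congr rfl; intro b _
    ring
  have e2 : x ^ s * bnP k (-s) x = bnK k s * ∑ a ∈ range (k+1), ∑ b ∈ range (k+1),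
      ((-1:ℝ)^a * (k.choose a) * ((-1:ℝ)^b * (k.choose b)) * x ^ a) * (x ^ (s + b - a) / (s - a + b)) := by
    unfold bnP
    rw [Finset.sum_comm, Finset.mul_sum, Finset.mul_sum]
    apply Finset.sum_congr rfl; intro b hb
    rw [← bn_coef (-s) hs' k b (by simpa [Nat.lt_succ_iff] using hb), hK, mul_comm (x^s), mul_assoc, mul_assoc,
      mul_assoc, mul_assoc, neg_mul, ← mul_neg,
      Finset.sum_mul, Finset.mul_sum, Finset.mul_sum, ← Finset.sum_neg_distrib]
    congr 1
    apply Finset.sum_congr rfl; intro a _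
    have : x ^ (s + b - a) = x ^ s * x ^ b / x ^ a := by
      have hx0 : 0 < x := by linarith
      rw [Real.rpow_sub hx0, Real.rpow_add hx0]
      simp
    rw [this]
    have hx0 : x ≠ 0 := by linarith
    have h1 : s - a + b ≠ 0 := by
      intro h; apply hs (b - a); push_cast; linarith
    have h2 : -s - b + a = -(s - a + b) := by ring
    rw [h2]
    field_simp
  rw [e1, e2, bn_integral k s x hx hs, ← mul_sub, ← Finset.sum_sub_distrib]
  congr 1
  apply Finset.sum_congr rfl; intro a _
  rw [← Finset.sum_sub_distrib]
  apply Finset.sum_congr rfl; intro b _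
  ring

lemma bnV_pos (s : ℝ) (hs : -1 < s) (j : ℕ) : 0 < bnV s j := by
  apply Finset.prod_pos
  intro i _
  have : (0:ℝ) ≤ i := by positivity
  linarith

lemma bnK_pos (s : ℝ) (h0 : 0 < s) (h1 : s < 1) (k : ℕ) : 0 < bnK k s := by
  unfold bnK
  have := bnV_pos s (by linarith) k
  have := bnV_pos (-s) (by linarith) k
  positivity

lemma bnK_succ (s : ℝ) (h0 : 0 < s) (h1 : s < 1) (k : ℕ) : bnK (k+1) s ≤ bnK k s := by
  have hk := bnK_pos s h0 h1 k
  have : bnK (k+1) s = bnK k s * (1 - s^2/((k:ℝ)+1)^2) := by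
    unfold bnK bnV
    rw [Finset.prod_range_succ, Finset.prod_range_succ, Nat.factorial_succ]
    push_cast
    have := Nat.factorial_ne_zero k
    have : (k:ℝ)+1 ≠ 0 := by positivity
    field_simp
    ring
  rw [this]
  have : 0 ≤ s^2/((k:ℝ)+1)^2 := by positivity
  nlinarith

lemma bnI_cont (k : ℕ) (s x : ℝ) (hx : 1 < x) :
    ContinuousOn (fun t : ℝ => ((x - t) * (t - 1) / t)^k * t ^ (s - 1)) (Set.Icc 1 x) := by
  have h : ∀ t ∈ Set.Icc 1 x, t ≠ 0 := by
    intro t ht; linarith [ht.1]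
  apply ContinuousOn.mul
  · apply ContinuousOn.pow
    apply ContinuousOn.div _ continuousOn_id h
    fun_prop
  · apply ContinuousOn.rpow_const continuousOn_id
    intro t ht; left; exact h t ht

lemma bnI_int (k : ℕ) (s x : ℝ) (hx : 1 < x) : IntervalIntegrable 
    (fun t : ℝ => ((x - t) * (t - 1) / t)^k * t ^ (s - 1)) MeasureTheory.volume 1 x := by
  apply ContinuousOn.intervalIntegrable
  rw [Set.uIcc_of_le hx.le]
  exact bnI_cont k s x hx

lemma bnI_pos (k : ℕ) (s x : ℝ) (hx : 1 < x) : 0 < bnI k s x := by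
  apply intervalIntegral.intervalIntegral_pos_of_pos_on (bnI_int k s x hx) _ hx
  intro t ht
  have h1 : 0 < x - t := by linarith [ht.2]
  have h2 : 0 < t - 1 := by linarith [ht.1]
  have h3 : 0 < t := by linarith
  positivity

lemma bnI_succ (k : ℕ) (s x : ℝ) (hx : 1 < x) : bnI (k+1) s x ≤ (√x - 1)^2 * bnI k s x := by
  unfold bnI
  rw [← intervalIntegral.integral_const_mul]
  apply intervalIntegral.integral_mono_on hx.le (bnI_int _ s x hx) ((bnI_int _ s x hx).const_mul _)
  intro t ht
  have h1 : 0 ≤ x - t := by linarith [ht.2]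
  have h2 : 0 ≤ t - 1 := by linarith [ht.1]
  have h3 : 0 < t := by linarith
  have hh : (x - t) * (t - 1) / t ≤ (√x - 1)^2 := by
    rw [div_le_iff₀ h3]
    have : √x ^ 2 = x := Real.sq_sqrt (by linarith)
    nlinarith [sq_nonneg (√x - t)]
  rw [pow_succ', mul_assoc]
  apply mul_le_mul_of_nonneg_right hh
  positivity

lemma bn_choose_pos_aux (c : ℝ) (j : ℕ) (h : (j:ℝ) - 1 < c) : 0 < Ring.choose c j := by
  have h1 := bn_choose_prod c j
  have h2 : 0 < ∏ i ∈ range j, (c - i) := by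
    apply Finset.prod_pos
    intro i hi
    have : i + 1 ≤ j := by simpa using hi
    have : (i:ℝ) + 1 ≤ j := by exact_mod_cast this
    linarith
  rw [← h1] at h2
  exact pos_of_mul_pos_right h2 (by positivity)

lemma bn_choose_mono (c d : ℝ) (j : ℕ) (h : (j:ℝ) - 1 < c) (hd : c ≤ d) :
    Ring.choose c j ≤ Ring.choose d j := by
  have h1 := bn_choose_prod c j
  have h2 := bn_choose_prod d j
  have h3 : ∏ i ∈ range j, (c - i) ≤ ∏ i ∈ range j, (d - i) := by
    apply Finset.prod_le_prod
    · intro i hi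
      have : i + 1 ≤ j := by simpa using hi
      have : (i:ℝ) + 1 ≤ j := by exact_mod_cast this
      linarith
    · intro i hi
      linarith
  rw [← h1, ← h2] at h3
  exact le_of_mul_le_mul_left h3 (by positivity)

lemma bn_choose_succ (c : ℝ) (j : ℕ) : ((j:ℝ)+1) * Ring.choose (c+1) (j+1) = (c+1) * Ring.choose c j := by
  have h1 := bn_choose_prod c j
  have h2 := bn_choose_prod (c+1) (j+1)
  rw [Finset.prod_range_succ'] at h2
  have : ∏ i ∈ range j, (c + 1 - (i+1:ℕ)) = ∏ i ∈ range j, (c - i) := by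
    apply Finset.prod_congr rfl; intros; push_cast; ring
  rw [this, ← h1, Nat.factorial_succ] at h2
  push_cast at h2
  have h3 : (j.factorial:ℝ) ≠ 0 := by positivity
  apply mul_left_cancel₀ h3
  linarith

lemma bn_vander (k : ℕ) (r s y : ℝ) :
    ∑ i ∈ range (k+1), Ring.choose r i * Ring.choose s (k-i) * (1+y)^i =
    ∑ j ∈ range (k+1), Ring.choose r j * Ring.choose (r + s - j) (k-j) * y^j := by
  have e1 : ∀ i ∈ range (k+1), Ring.choose r i * Ring.choose s (k-i) * (1+y)^i = 
      ∑ j ∈ range (i+1), Ring.choose r i * Ring.choose s (k-i) * (i.choose j * y^j) := by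
    intro i _
    rw [← Finset.mul_sum, add_comm 1 y, add_pow]
    congr 1
    apply Finset.sum_congr rfl; intros; simp; ring
  rw [Finset.sum_congr rfl e1]
  rw [Finset.sum_comm' (t' := range (k+1)) (s' := fun j => Finset.Ico j (k+1))]
  swap
  · intro i j; simp; omega
  apply Finset.sum_congr rfl
  intro j hj
  have hj : j ≤ k := by simpa [Nat.lt_succ_iff] using hj
  rw [Finset.sum_Ico_eq_sum_range]
  rw [show r + s - j = (r - j) + s by ring, Ring.add_choose_eq _ (Commute.all _ _),
    Finset.Nat.sum_antidiagonal_eq_sum_range_succ_mk, show (k-j).succ = k + 1 - j by omega,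
    Finset.mul_sum, Finset.sum_mul]
  apply Finset.sum_congr rfl
  intro i hi
  have := Ring.choose_smul_choose r (n := j + i) (k := j) (by omega)
  rw [nsmul_eq_mul, Nat.add_sub_cancel_left] at this
  rw [Nat.sub_sub]
  linear_combination (Ring.choose s (k - (j + i)) * y^j) * this

lemma bn_sum_sq (f : ℕ → ℝ) (m : ℕ) (h : ∀ i, 0 ≤ f i) :
    ∑ i ∈ range m, f i ^ 2 ≤ (∑ i ∈ range m, f i)^2 := by
  induction m with
  | zero => simp
  | succ m ih =>
    rw [Finset.sum_range_succ, Finset.sum_range_succ]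
    have := h m
    have : 0 ≤ ∑ i ∈ range m, f i := Finset.sum_nonneg (fun i _ => h i)
    nlinarith [mul_nonneg this (h m)]

lemma bnQ_le (k : ℕ) (s x : ℝ) (h0 : 0 < s) (h1 : s < 1) (hx : 1 < x) :
    bnP k (-s) x ≤ (1 + √x)^(2*k) := by
  have e1 : bnP k (-s) x = ∑ i ∈ range (k+1), Ring.choose ((k:ℝ) - s) i * Ring.choose ((k:ℝ)+s) (k-i) * (1+(x-1))^i := by
    unfold bnP bnW
    apply Finset.sum_congr rfl; intro i _
    rw [sub_neg_eq_add, ← sub_eq_add_neg]; ring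
  have e2 : ∑ i ∈ range (k+1), Ring.choose (k:ℝ) i * Ring.choose (k:ℝ) (k-i) * (1+(x-1))^i
      = ∑ i ∈ range (k+1), ((k.choose i) * √x ^ i)^2 := by
    apply Finset.sum_congr rfl; intro i hi
    have hi : i ≤ k := by simpa [Nat.lt_succ_iff] using hi
    rw [Ring.choose_natCast, Ring.choose_natCast, Nat.choose_symm hi, mul_pow, ← pow_mul, mul_comm i 2, pow_mul,
      Real.sq_sqrt (by linarith)]
    ring
  have e3 : (1 + √x)^(2*k) = (∑ i ∈ range (k+1), ((k.choose i) * √x ^ i))^2 := by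
    rw [mul_comm, pow_mul, add_comm, add_pow]
    congr 1
    apply Finset.sum_congr rfl; intros; simp; ring
  rw [e1, bn_vander, e3]
  refine le_trans ?_ (bn_sum_sq _ _ (fun i => by positivity))
  rw [← e2, bn_vander]
  apply Finset.sum_le_sum
  intro j hj
  have hj : j ≤ k := by simpa [Nat.lt_succ_iff] using hj
  have hj' : (j:ℝ) ≤ k := by exact_mod_cast hj
  rw [show (k:ℝ) - s + (k + s) - j = k + k - j by ring]
  apply mul_le_mul_of_nonneg_right _ (by have : 0 < x - 1 := by linarith
                                         positivity)
  apply mul_le_mul_of_nonneg_right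
  · apply bn_choose_mono <;> linarith
  · apply le_of_lt; apply bn_choose_pos_aux
    rw [Nat.cast_sub hj]; linarith

lemma bnQ_pos (k : ℕ) (s x : ℝ) (h0 : 0 < s) (h1 : s < 1) (hx : 1 < x) :
    0 < bnP k (-s) x := by
  unfold bnP bnW
  apply Finset.sum_pos _ (by simp)
  intro i hi
  have hi : i ≤ k := by simpa [Nat.lt_succ_iff] using hi
  have hi' : (i:ℝ) ≤ k := by exact_mod_cast hi
  have a1 : 0 < Ring.choose ((k:ℝ) - -s) (k-i) := by
    apply bn_choose_pos_aux; rw [Nat.cast_sub hi]; have : (0:ℝ) ≤ i := by positivity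
    linarith
  have a2 : 0 < Ring.choose ((k:ℝ) + -s) i := by
    apply bn_choose_pos_aux; linarith
  have : 0 < x := by linarith
  positivity

lemma bnQ_succ (k : ℕ) (s x : ℝ) (h0 : 0 < s) (h1 : s < 1) (hx : 1 < x) :
    (1 - s) * bnP k (-s) x ≤ bnP (k+1) (-s) x := by
  unfold bnP
  rw [Finset.sum_range_succ' _ (k+1), Finset.mul_sum]
  have hx0 : 0 < x := by linarith
  have hnn : 0 ≤ bnW (k+1) (-s) 0 * x^0 := by
    unfold bnW
    have : 0 < Ring.choose (((k+1:ℕ):ℝ) - -s) (k+1-0) := by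
      apply bn_choose_pos_aux; push_cast; linarith
    simp at this ⊢
    exact this.le
  refine le_trans ?_ (le_add_of_nonneg_right hnn)
  apply Finset.sum_le_sum
  intro i hi
  have hi : i ≤ k := by simpa [Nat.lt_succ_iff] using hi
  have hi' : (i:ℝ) ≤ k := by exact_mod_cast hi
  have hi0 : (0:ℝ) ≤ i := by positivity
  unfold bnW
  rw [Nat.add_sub_add_right]
  have a1 : 0 < Ring.choose ((k:ℝ) - -s) (k-i) := by
    apply bn_choose_pos_aux; rw [Nat.cast_sub hi]
    linarith
  have a2 : 0 < Ring.choose ((k:ℝ) + -s) i := by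
    apply bn_choose_pos_aux; linarith
  have b1 : Ring.choose ((k:ℝ) - -s) (k-i) ≤ Ring.choose (((k+1:ℕ):ℝ) - -s) (k-i) := by
    apply bn_choose_mono
    · rw [Nat.cast_sub hi]; linarith
    · push_cast; linarith
  have b2 : (1 - s) * Ring.choose ((k:ℝ) + -s) i ≤ Ring.choose (((k+1:ℕ):ℝ) + -s) (i+1) := by
    have := bn_choose_succ ((k:ℝ) + -s) i
    rw [show ((k+1:ℕ):ℝ) + -s = (k:ℝ) + -s + 1 by push_cast; ring]
    have hp : (0:ℝ) < i + 1 := by positivity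
    rw [← mul_le_mul_iff_right₀ hp, this, ← mul_assoc]
    apply mul_le_mul_of_nonneg_right _ a2.le
    nlinarith
  have b3 : x ^ i ≤ x ^ (i+1) := pow_le_pow_right₀ hx.le (by omega)
  calc (1 - s) * (Ring.choose ((k:ℝ) - -s) (k-i) * Ring.choose ((k:ℝ) + -s) i * x ^ i)
      = Ring.choose ((k:ℝ) - -s) (k-i) * ((1 - s) * Ring.choose ((k:ℝ) + -s) i) * x ^ i := by ring
    _ ≤ _ := by
      have : 0 < 1 - s := by linarith
      have c1 : 0 ≤ Ring.choose (((k+1:ℕ):ℝ) - -s) (k-i) := le_trans a1.le b1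
      have c2 : 0 ≤ Ring.choose (((k+1:ℕ):ℝ) + -s) (i+1) := le_trans (by positivity) b2
      apply mul_le_mul _ b3 (by positivity) (by positivity)
      exact mul_le_mul b1 b2 (by positivity) c1

def bnA (n k : ℕ) : ℕ := ∏ l ∈ n.primeFactors, l ^ ((k.factorial).factorization l)

lemma bnA_pos (n k : ℕ) : 0 < bnA n k :=
  Finset.prod_pos (fun l hl => pow_pos (Nat.prime_of_mem_primeFactors hl).pos _)

lemma bnA_le (n k : ℕ) : (bnA n k : ℝ) ≤ (∏ l ∈ n.primeFactors, (l : ℝ) ^ ((1 : ℝ) / ((l : ℝ) - 1)))^k := by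
  unfold bnA
  push_cast
  rw [← Finset.prod_pow]
  apply Finset.prod_le_prod
  · intro l _; positivity
  intro l hl
  have hp := Nat.prime_of_mem_primeFactors hl
  have : Fact l.Prime := ⟨hp⟩
  have h2 : (2:ℝ) ≤ l := by exact_mod_cast hp.two_le
  rw [← Real.rpow_natCast, ← Real.rpow_natCast, ← Real.rpow_mul (by positivity)]
  apply Real.rpow_le_rpow_of_exponent_le (by linarith)
  have h := sub_one_mul_padicValNat_factorial (p := l) k
  rw [← Nat.factorization_def _ hp] at h
  have h3 : (l - 1) * (k.factorial).factorization l ≤ k := by omega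
  have h4 : ((l:ℝ) - 1) * ((k.factorial).factorization l : ℝ) ≤ k := by
    have : (((l - 1) * (k.factorial).factorization l : ℕ):ℝ) ≤ k := by exact_mod_cast h3
    rwa [Nat.cast_mul, Nat.cast_sub hp.one_le, Nat.cast_one] at this
  rw [one_div, ← div_eq_inv_mul, le_div_iff₀ (by linarith)]
  linarith

lemma bnA_mul_dvd (n i j : ℕ) : bnA n i * bnA n j ∣ bnA n (i+j) := by
  unfold bnA
  rw [← Finset.prod_mul_distrib]
  apply Finset.prod_dvd_prod_of_dvd
  intro l _
  rw [← pow_add]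
  apply pow_dvd_pow
  have h := Nat.factorial_mul_factorial_dvd_factorial_add i j
  have h2 := (Nat.factorization_le_iff_dvd (by positivity) (by positivity)).2 h
  rw [Nat.factorization_mul (by positivity) (by positivity)] at h2
  exact h2 l

lemma bnA_split (n k : ℕ) (hn : n ≠ 0) : ∃ B : ℕ, k.factorial = bnA n k * B ∧ Nat.Coprime n B := by
  refine ⟨∏ l ∈ (k.factorial.primeFactors ∪ n.primeFactors) \ n.primeFactors,
    l ^ ((k.factorial).factorization l), ?_, ?_⟩
  · unfold bnA
    rw [mul_comm, Finset.prod_sdiff Finset.subset_union_right]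
    have h := Nat.prod_factorization_pow_eq_self (Nat.factorial_ne_zero k)
    rw [Finsupp.prod, Nat.support_factorization] at h
    conv_lhs => rw [← h]
    apply Finset.prod_subset Finset.subset_union_left
    intro l _ hl
    rw [← Nat.support_factorization, Finsupp.notMem_support_iff] at hl
    rw [hl, pow_zero]
  · apply Nat.Coprime.prod_right
    intro l hl
    rw [Finset.mem_sdiff, Finset.mem_union] at hl
    have hp : l.Prime := by
      rcases hl.1 with h | h <;> exact Nat.prime_of_mem_primeFactors h
    apply Nat.Coprime.pow_right
    rw [Nat.coprime_comm, hp.coprime_iff_not_dvd]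
    intro hd
    exact hl.2 (Nat.mem_primeFactors.2 ⟨hp, hd, hn⟩)

lemma bn_dvd_prod (n B j : ℕ) (hB : Nat.Coprime n B) (hj : B ∣ j.factorial) (c : ℤ) :
    (B:ℤ) ∣ ∏ i ∈ range j, (c - i * n) := by
  obtain ⟨m, hm⟩ : ∃ m : ℤ, (n:ℤ) * m ≡ 1 [ZMOD B] := by
    have : IsCoprime (n:ℤ) (B:ℤ) := Nat.isCoprime_iff_coprime.2 hB
    obtain ⟨u, v, huv⟩ := this
    refine ⟨u, (Int.modEq_iff_dvd.2 ⟨v, by linarith⟩)⟩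
  have h1 : (B:ℤ) ∣ ∏ i ∈ range j, (c * m - i) := by
    rw [← bn_choose_prod]
    exact Dvd.dvd.mul_right (by exact_mod_cast hj) _
  have h2 : ∏ i ∈ range j, (c * m - i) ≡ m ^ j * ∏ i ∈ range j, (c - i * n) [ZMOD B] := by
    rw [show m ^ j = ∏ i ∈ range j, m by simp, ← Finset.prod_mul_distrib]
    apply Int.ModEq.prod
    intro i _
    have := (hm.mul_left (-(i:ℤ))).add_left (c*m)
    rw [show m * (c - i * n) = c * m + -i * (n*m) by ring]
    rw [show c * m - i = c * m + -i * 1 by ring]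
    exact this.symm
  have h3 : (B:ℤ) ∣ m ^ j * ∏ i ∈ range j, (c - i * n) := (Int.ModEq.dvd_iff h2).1 h1
  have h4 : IsCoprime (B:ℤ) m := by
    obtain ⟨t, ht⟩ := hm.dvd
    exact ⟨t, n, by linarith⟩
  exact (h4.pow_right).dvd_of_dvd_mul_left h3

lemma bn_choose_int (n j : ℕ) (hn : n ≠ 0) (c : ℤ) :
    ∃ z : ℤ, (n:ℝ)^j * bnA n j * Ring.choose ((c:ℝ)/n) j = z := by
  obtain ⟨B, hB, hc⟩ := bnA_split n j hn
  obtain ⟨z, hz⟩ := bn_dvd_prod n B j hc ⟨_, by rw [hB, mul_comm]⟩ c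
  refine ⟨z, ?_⟩
  have h1 := bn_choose_prod ((c:ℝ)/n) j
  have hn' : (n:ℝ) ≠ 0 := by exact_mod_cast hn
  have h2 : (n:ℝ)^j * ∏ i ∈ range j, ((c:ℝ)/n - i) = ((∏ i ∈ range j, (c - i * n) : ℤ) : ℝ) := by
    rw [show (n:ℝ)^j = ∏ i ∈ range j, (n:ℝ) by simp, ← Finset.prod_mul_distrib]
    push_cast
    apply Finset.prod_congr rfl; intro i _
    field_simp
  rw [hz, ← h1, hB] at h2
  push_cast at h2
  have hB0 : (B:ℝ) ≠ 0 := by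
    intro h
    have : B = 0 := by exact_mod_cast h
    rw [this] at hB
    exact Nat.factorial_ne_zero j (by simpa using hB)
  apply mul_left_cancel₀ hB0
  linarith

lemma bn_P_int (n k N : ℕ) (hn : n ≠ 0) (hN : 0 < N) (e : ℤ) :
    ∃ z : ℤ, (n:ℝ)^k * bnA n k * (N:ℝ)^k * bnP k ((e:ℝ)/n) (1 + 1/(N:ℝ)) = z := by
  have hn' : (n:ℝ) ≠ 0 := by exact_mod_cast hn
  have hN' : (N:ℝ) ≠ 0 := by positivity
  have h : ∀ a : ℕ, ∃ z : ℤ, a ≤ k → (n:ℝ)^k * bnA n k * (N:ℝ)^k * (bnW k ((e:ℝ)/n) a * (1 + 1/(N:ℝ))^a) = z := by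
    intro a
    by_cases ha : a ≤ k
    swap
    · exact ⟨0, fun h => absurd h ha⟩
    obtain ⟨z1, h1⟩ := bn_choose_int n (k-a) hn (k * n - e)
    obtain ⟨z2, h2⟩ := bn_choose_int n a hn (k * n + e)
    obtain ⟨d, hd⟩ := bnA_mul_dvd n (k-a) a
    rw [Nat.sub_add_cancel ha] at hd
    refine ⟨z1 * z2 * d * (N+1)^a * N^(k-a), fun _ => ?_⟩
    unfold bnW
    rw [hd]
    push_cast
    rw [← h1, ← h2]
    push_cast
    have e1 : (n:ℝ)^k = n^(k-a) * n^a := by rw [← pow_add, Nat.sub_add_cancel ha]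
    have e2 : (N:ℝ)^k = N^(k-a) * N^a := by rw [← pow_add, Nat.sub_add_cancel ha]
    have e3 : (N+1:ℝ)^a = N^a * (1 + 1/(N:ℝ))^a := by
      rw [← mul_pow]; congr 1; field_simp
    have e4 : ((k:ℝ) * n - e)/n = k - e/n := by field_simp
    have e5 : ((k:ℝ) * n + e)/n = k + e/n := by field_simp
    rw [e1, e2, e3, e4, e5]
    ring
  choose f hf using h
  refine ⟨∑ a ∈ range (k+1), f a, ?_⟩
  unfold bnP
  rw [Finset.mul_sum]
  push_cast
  apply Finset.sum_congr rfl
  intro a ha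
  exact hf a (by simpa [Nat.lt_succ_iff] using ha)

lemma bn_R_pos (k : ℕ) (s x : ℝ) (h0 : 0 < s) (h1 : s < 1) (hx : 1 < x) :
    0 < bnK k s * bnI k s x := mul_pos (bnK_pos s h0 h1 k) (bnI_pos k s x hx)

lemma bn_R_succ (k : ℕ) (s x : ℝ) (h0 : 0 < s) (h1 : s < 1) (hx : 1 < x) :
    bnK (k+1) s * bnI (k+1) s x ≤ (√x - 1)^2 * (bnK k s * bnI k s x) := by
  have a1 := bnK_succ s h0 h1 k
  have a2 := bnI_succ k s x hx
  have a3 := bnI_pos (k+1) s x hx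
  have a4 := bnK_pos s h0 h1 k
  calc bnK (k+1) s * bnI (k+1) s x ≤ bnK k s * ((√x - 1)^2 * bnI k s x) :=
        mul_le_mul a1 a2 a3.le a4.le
    _ = _ := by ring

lemma bn_not_int (s : ℝ) (h0 : 0 < s) (h1 : s < 1) (m : ℤ) : s + m ≠ 0 := by
  intro h
  have e1 : (-1:ℝ) < m := by linarith
  have e2 : (m:ℝ) < 0 := by linarith
  have e3 : (-1:ℤ) < m := by exact_mod_cast e1
  have e4 : m < 0 := by exact_mod_cast e2
  omega

lemma bn_R_le (k : ℕ) (s x : ℝ) (h0 : 0 < s) (h1 : s < 1) (hx : 1 < x) :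
    bnK k s * bnI k s x ≤ (x ^ s - 1) * ((√x - 1)^2)^k := by
  induction k with
  | zero =>
    rw [bn_main_identity 0 s x hx (bn_not_int s h0 h1)]
    simp [bnP, bnW]
  | succ k ih =>
    refine (bn_R_succ k s x h0 h1 hx).trans ?_
    rw [pow_succ ((√x - 1)^2) k]
    have := mul_le_mul_of_nonneg_left ih (sq_nonneg (√x - 1))
    linarith

lemma bn_ratio_aux (Q0 Q1 R0 R1 d s : ℝ) (hs1 : s ≤ 1/3) (q0 : 0 < Q0) (q1 : (1 - s) * Q0 ≤ Q1)
    (r0 : 0 < R0) (r1 : R1 ≤ d * R0) (hd : d ≤ 1/4) (h : Q1 * R0 = Q0 * R1) : False := by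
  have c1 : (2/3) * Q0 ≤ Q1 := le_trans (by gcongr; linarith) q1
  have c2 : R1 ≤ (1/4) * R0 := le_trans r1 (by gcongr)
  have c3 : (2/3) * Q0 * R0 ≤ Q1 * R0 := by gcongr
  have c4 : Q0 * R1 ≤ Q0 * ((1/4) * R0) := by gcongr
  nlinarith [mul_pos q0 r0]

lemma bn_seq (n N : ℕ) (hn : 3 ≤ n) (hN : 0 < N) (μ S θ : ℝ)
    (hμ : μ = ∏ l ∈ n.primeFactors, (l : ℝ) ^ ((1 : ℝ) / ((l : ℝ) - 1)))
    (hS : S = (√(N:ℝ) + √((N:ℝ)+1))^2) (hθ : θ = (1 + 1 / (N : ℝ)) ^ ((1 : ℝ) / n)) :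
    ∃ P Q : ℕ → ℤ, ∀ k, 0 < (Q k : ℝ) ∧ (Q k : ℝ) ≤ (n * μ * S)^k ∧
      0 < Q k * θ - P k ∧ Q k * θ - P k ≤ (θ - 1) * (n * μ / S)^k ∧
      P k * Q (k+1) ≠ P (k+1) * Q k := by
  have hn0 : n ≠ 0 := by omega
  have hN0 : (0:ℝ) < N := by exact_mod_cast hN
  have hN1 : (1:ℝ) ≤ N := by exact_mod_cast hN
  have hn3 : (3:ℝ) ≤ n := by exact_mod_cast hn
  set x : ℝ := 1 + 1 / (N:ℝ) with hxdef
  set s : ℝ := (1:ℝ)/n with hsdef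
  have hs0 : 0 < s := by positivity
  have hs1 : s ≤ 1/3 := by rw [hsdef]; gcongr
  have hs1' : s < 1 := by linarith
  have hx : 1 < x := by rw [hxdef]; have : 0 < 1/(N:ℝ) := by positivity
                        linarith
  have hx2 : x ≤ 2 := by
    have : 1/(N:ℝ) ≤ 1 := by rw [div_le_one hN0]; exact hN1
    rw [hxdef]; linarith
  have hQ := fun k => bn_P_int n k N hn0 hN (-1)
  have hP := fun k => bn_P_int n k N hn0 hN 1
  choose Q hQ using hQ
  choose P hP using hP
  have es : (((-1:ℤ):ℝ)/n) = -s := by rw [hsdef]; push_cast; ring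
  have es' : (((1:ℤ):ℝ)/n) = s := by rw [hsdef]; push_cast; ring
  have hQ : ∀ k, (n:ℝ)^k * bnA n k * (N:ℝ)^k * bnP k (-s) x = Q k := by
    intro k; rw [← hQ k, es]
  have hP : ∀ k, (n:ℝ)^k * bnA n k * (N:ℝ)^k * bnP k s x = P k := by
    intro k; rw [← hP k, es']
  have hC : ∀ k, 0 < (n:ℝ)^k * bnA n k * (N:ℝ)^k := by
    intro k
    have : 0 < (bnA n k : ℝ) := by exact_mod_cast bnA_pos n k
    positivity
  have hR : ∀ k, Q k * θ - P k = (n:ℝ)^k * bnA n k * (N:ℝ)^k * (bnK k s * bnI k s x) := by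
    intro k
    rw [bn_main_identity k s x hx (bn_not_int s hs0 hs1'), ← hQ, ← hP, hθ]
    ring
  have hA : ∀ k, (n:ℝ)^k * bnA n k ≤ (n * μ)^k := by
    intro k
    rw [mul_pow, hμ]
    exact mul_le_mul_of_nonneg_left (bnA_le n k) (by positivity)
  have hsq : √(N:ℝ) * √x = √((N:ℝ)+1) := by
    rw [← Real.sqrt_mul hN0.le]; congr 1; rw [hxdef]; field_simp
  have hN2 : √(N:ℝ)^2 = N := Real.sq_sqrt hN0.le
  have hN3 : √((N:ℝ)+1)^2 = N + 1 := Real.sq_sqrt (by linarith)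
  have hS1 : S = N * (1 + √x)^2 := by
    rw [hS, ← hsq]
    nth_rw 3 [← hN2]
    ring
  have hSpos : 0 < S := by rw [hS]; positivity
  have hS2 : 1 / S = N * (√x - 1)^2 := by
    have : (N:ℝ) * (√x - 1)^2 = (√((N:ℝ)+1) - √(N:ℝ))^2 := by
      rw [← hsq]
      nth_rw 1 [← hN2]
      ring
    rw [this, div_eq_iff hSpos.ne', hS, ← mul_pow]
    have : (√((N:ℝ)+1) - √(N:ℝ)) * (√(N:ℝ) + √((N:ℝ)+1)) = 1 := by nlinarith
    rw [this, one_pow]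
  have hμ0 : 0 < μ := by
    rw [hμ]; apply Finset.prod_pos
    intro l hl
    have := (Nat.prime_of_mem_primeFactors hl).pos
    positivity
  have hθ1 : 1 ≤ θ := by
    rw [hθ]; exact Real.one_le_rpow hx.le hs0.le
  refine ⟨P, Q, fun k => ⟨?_, ?_, ?_, ?_, ?_⟩⟩
  · rw [← hQ]; exact mul_pos (hC k) (bnQ_pos k s x hs0 hs1' hx)
  · rw [← hQ, mul_pow, hS1, mul_pow (N:ℝ), ← mul_assoc, ← pow_mul]
    have := bnQ_le k s x hs0 hs1' hx
    have h2 := bnQ_pos k s x hs0 hs1' hx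
    have h3 := hA k
    gcongr
  · rw [hR]; exact mul_pos (hC k) (bn_R_pos k s x hs0 hs1' hx)
  · rw [hR, div_eq_mul_one_div, hS2, mul_pow, mul_pow (N:ℝ)]
    have h1 := bn_R_le k s x hs0 hs1' hx
    have h2 := bn_R_pos k s x hs0 hs1' hx
    rw [← hθ] at h1
    calc _ ≤ (n*μ)^k * (N:ℝ)^k * ((θ - 1) * ((√x - 1)^2)^k) := by
          have h3 := hA k
          gcongr
      _ = _ := by ring
  · intro h
    have h' : (P k : ℝ) * Q (k+1) = P (k+1) * Q k := by exact_mod_cast h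
    have h1 : (Q (k+1):ℝ) * (Q k * θ - P k) = Q k * (Q (k+1) * θ - P (k+1)) := by linarith
    rw [hR, hR, ← hQ, ← hQ] at h1
    have h2 : bnP (k+1) (-s) x * (bnK k s * bnI k s x) = bnP k (-s) x * (bnK (k+1) s * bnI (k+1) s x) := by
      apply mul_left_cancel₀ (mul_pos (hC k) (hC (k+1))).ne'
      linarith
    have q0 := bnQ_pos k s x hs0 hs1' hx
    have q1 := bnQ_succ k s x hs0 hs1' hx
    have r0 := bn_R_pos k s x hs0 hs1' hx
    have r1 := bn_R_succ k s x hs0 hs1' hx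
    have hsx : (√x - 1)^2 ≤ 1/4 := by
      have a : 1 ≤ √x := Real.one_le_sqrt.2 hx.le
      have b : √x ≤ 3/2 := by
        rw [Real.sqrt_le_left (by norm_num)]; linarith
      nlinarith
    exact bn_ratio_aux _ _ _ _ _ s hs1 q0 q1 r0 r1 hsx h2

lemma bn_mu_ge (n : ℕ) : 1 ≤ ∏ l ∈ n.primeFactors, (l : ℝ) ^ ((1 : ℝ) / ((l : ℝ) - 1)) := by
  have : ∀ s : Finset ℕ, (∀ l ∈ s, Nat.Prime l) → 1 ≤ ∏ l ∈ s, (l : ℝ) ^ ((1 : ℝ) / ((l : ℝ) - 1)) := by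
    intro s hs
    calc (1:ℝ) = ∏ l ∈ s, 1 := by simp
      _ ≤ _ := by
        apply Finset.prod_le_prod
        · intros; norm_num
        · intro l hl
          have h2 : (2:ℝ) ≤ l := by exact_mod_cast (hs l hl).two_le
          apply Real.one_le_rpow (by linarith)
          apply div_nonneg (by norm_num) (by linarith)
  exact this _ (fun l hl => Nat.prime_of_mem_primeFactors hl)

lemma bn_mu_three : (3/2:ℝ) ≤ ∏ l ∈ (3:ℕ).primeFactors, (l : ℝ) ^ ((1 : ℝ) / ((l : ℝ) - 1)) := by
  rw [Nat.prime_three.primeFactors, Finset.prod_singleton]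
  have : (1:ℝ) / (((3:ℕ):ℝ) - 1) = 1/2 := by norm_num
  rw [this, ← Real.sqrt_eq_rpow]
  apply Real.le_sqrt_of_sq_le
  norm_num

lemma bn_const (n N : ℕ) (hn : 3 ≤ n) (hN : 0 < N) (μ S : ℝ)
    (hμ : μ = ∏ l ∈ n.primeFactors, (l : ℝ) ^ ((1 : ℝ) / ((l : ℝ) - 1)))
    (hS : S < 4 * N + 2) (hS0 : 0 < S) (hc : ((n:ℝ) * μ)^n < S ^ (n-2)) :
    2 * (2 * (N:ℝ) + 1)^2 ≤ n^2 * μ * N^2 := by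
  have hN1 : (1:ℝ) ≤ N := by exact_mod_cast hN
  have hμ1 : 1 ≤ μ := by rw [hμ]; exact bn_mu_ge n
  have hn3 : (3:ℝ) ≤ n := by exact_mod_cast hn
  rcases Nat.lt_or_ge n 5 with h | h
  · interval_cases n
    · have h2 := bn_mu_three
      rw [← hμ] at h2
      norm_num at hc
      have a : (27:ℝ) ≤ (3 * μ)^3 := by
        have : (3:ℝ)^3 ≤ (3 * μ)^3 := by gcongr; linarith
        linarith
      have hN2 : (6:ℝ) ≤ N := by linarith
      push_cast
      nlinarith [mul_nonneg (by linarith : (0:ℝ) ≤ μ - 3/2) (sq_nonneg (N:ℝ))]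
    · norm_num at hc
      have a : (256:ℝ) ≤ (4 * μ)^4 := by
        have : (4:ℝ)^4 ≤ (4 * μ)^4 := by gcongr; linarith
        linarith
      have hS16 : 16 < S := by nlinarith
      have hN2 : (3:ℝ) ≤ N := by linarith
      push_cast
      nlinarith [mul_nonneg (by linarith : (0:ℝ) ≤ μ - 1) (sq_nonneg (N:ℝ))]
  · have h5 : (5:ℝ) ≤ n := by exact_mod_cast h
    have : (25:ℝ) * N^2 ≤ n^2 * μ * N^2 := by
      gcongr
      nlinarith
    nlinarith

end BennettAux

set_option maxHeartbeats 2000000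

/-- Bennett's lower bound for rational approximations to `(1 + 1/N)^{1/n}`. -/
theorem bennett_rational_approx_lower_bound
    (p q n N : ℕ) (hp : 0 < p) (hq : 0 < q) (hN : 0 < N) (hn : 3 ≤ n)
    (μ lam : ℝ)
    (hμ : μ = ∏ l ∈ n.primeFactors, (l : ℝ) ^ ((1 : ℝ) / ((l : ℝ) - 1)))
    (hcond : (Real.sqrt N + Real.sqrt (N + 1)) ^ (2 * (n - 2)) > ((n : ℝ) * μ) ^ n)
    (hlam : lam = 1 + Real.log ((n : ℝ) * μ * (Real.sqrt N + Real.sqrt (N + 1)) ^ 2) /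
      Real.log ((1 / ((n : ℝ) * μ)) * (Real.sqrt N + Real.sqrt (N + 1)) ^ 2)) :
    |(1 + 1 / (N : ℝ)) ^ ((1 : ℝ) / n) - (p : ℝ) / q| >
      (8 * n * μ * N)⁻¹ * (q : ℝ) ^ (-lam) := by
  have hN0 : (0:ℝ) < N := by exact_mod_cast hN
  have hN1 : (1:ℝ) ≤ N := by exact_mod_cast hN
  have hn3 : (3:ℝ) ≤ n := by exact_mod_cast hn
  have hμ1 : 1 ≤ μ := by rw [hμ]; exact bn_mu_ge n
  obtain ⟨S, hS⟩ : ∃ S : ℝ, S = (√(N:ℝ) + √((N:ℝ)+1))^2 := ⟨_, rfl⟩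
  obtain ⟨θ, hθ⟩ : ∃ θ : ℝ, θ = (1 + 1 / (N : ℝ)) ^ ((1 : ℝ) / n) := ⟨_, rfl⟩
  obtain ⟨P, Q, hPQ⟩ := bn_seq n N hn hN μ S θ hμ hS hθ
  rw [pow_mul, ← hS] at hcond
  rw [← hS] at hlam
  rw [← hθ]
  have hN2 : √(N:ℝ)^2 = N := Real.sq_sqrt hN0.le
  have hN3 : √((N:ℝ)+1)^2 = N + 1 := Real.sq_sqrt (by linarith)
  have hNlt : √(N:ℝ) < √((N:ℝ)+1) := Real.sqrt_lt_sqrt hN0.le (by linarith)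
  have hsN : 0 < √(N:ℝ) := Real.sqrt_pos.2 hN0
  have hSlt : S < 4 * N + 2 := by rw [hS]; nlinarith [mul_pos (sub_pos.2 hNlt) (sub_pos.2 hNlt)]
  have hSge : 4 * N ≤ S := by rw [hS]; nlinarith
  have hS0 : 0 < S := by linarith
  have hcst := bn_const n N hn hN μ S hμ hSlt hS0 hcond
  clear hμ hN2 hN3 hNlt hsN hS
  obtain ⟨X, hX⟩ : ∃ X : ℝ, X = n * μ := ⟨_, rfl⟩
  rw [← hX] at hcond hlam hPQ
  have hX3 : 3 ≤ X := by rw [hX]; nlinarith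
  have hX0 : 0 < X := by linarith
  have hXn : (n:ℝ) ≤ X := by rw [hX]; nlinarith
  have hSX : X < S := by
    have : X ^ (n-2) < S ^ (n-2) := lt_of_le_of_lt (pow_le_pow_right₀ (by linarith) (by omega)) hcond
    exact lt_of_pow_lt_pow_left₀ _ hS0.le this
  clear hcond
  obtain ⟨E, hE⟩ : ∃ E : ℝ, E = S / X := ⟨_, rfl⟩
  have hE1 : 1 < E := by rw [hE, one_lt_div hX0]; exact hSX
  obtain ⟨τ, hτ⟩ : ∃ τ : ℝ, τ = Real.log (X * S) / Real.log E := ⟨_, rfl⟩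
  have hlam' : lam = 1 + τ := by
    rw [hlam, hτ, hE]; congr 3; ring
  have hlogE : 0 < Real.log E := Real.log_pos hE1
  have hτ1 : 1 < τ := by
    rw [hτ, one_lt_div hlogE]
    apply Real.log_lt_log (by linarith)
    rw [hE, div_lt_iff₀ hX0]
    nlinarith [mul_pos hS0 hX0]
  have hEτ : E ^ τ = X * S := by
    rw [Real.rpow_def_of_pos (by linarith), hτ, mul_div_cancel₀ _ hlogE.ne', Real.exp_log (by positivity)]
  clear hlam
  have hθle : θ ≤ 1 + 1 / (n * N) := by
    rw [hθ]
    refine (_root_.rpow_one_add_le_one_add_mul_self (s := 1/(N:ℝ)) (p := 1/(n:ℝ)) ?_ (by positivity) ?_).trans ?_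
    · have : 0 < 1/(N:ℝ) := by positivity
      linarith
    · rw [div_le_one (by linarith)]; linarith
    · rw [one_div_mul_one_div]
  have hθge : 1 / (n * (N+1)) ≤ θ - 1 := by
    rw [hθ, Real.rpow_def_of_pos (by positivity)]
    have h1 := Real.add_one_le_exp (Real.log (1 + 1/(N:ℝ)) * (1/(n:ℝ)))
    have h2 := Real.one_sub_inv_le_log_of_pos (show 0 < 1 + 1/(N:ℝ) by positivity)
    have h3 : 1 - (1 + 1/(N:ℝ))⁻¹ = 1/(N+1) := by field_simp; ring
    rw [h3] at h2
    have h4 : 1/(N+1:ℝ) * (1/(n:ℝ)) ≤ Real.log (1 + 1/(N:ℝ)) * (1/(n:ℝ)) := by gcongr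
    have h5 : 1 / ((n:ℝ) * (N+1)) = 1/(N+1:ℝ) * (1/(n:ℝ)) := by field_simp
    linarith
  have hXN : 8 * (n:ℝ) * μ * N = 8 * X * N := by rw [hX]; ring
  rw [hXN]
  clear hXN
  have hθ1 : 0 < θ - 1 := lt_of_lt_of_le (by positivity) hθge
  have hθ2 : θ - 1 ≤ 1 / (n * N) := by linarith
  have hq1 : (1:ℝ) ≤ q := by exact_mod_cast hq
  have hq0 : (0:ℝ) < q := by linarith
  rcases Nat.lt_or_ge q 2 with hq2 | hq2
  · have : q = 1 := by omega
    subst this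
    simp only [Nat.cast_one, div_one, Real.one_rpow, mul_one]
    have hle : (8 * X * N)⁻¹ ≤ 1/24 := by
      rw [inv_eq_one_div]; apply one_div_le_one_div_of_le (by norm_num); nlinarith
    rcases Nat.lt_or_ge p 2 with hp2 | hp2
    · have : p = 1 := by omega
      subst this
      rw [Nat.cast_one, abs_of_pos hθ1]
      refine lt_of_lt_of_le ?_ hθge
      rw [inv_eq_one_div]
      apply one_div_lt_one_div_of_lt (by positivity)
      nlinarith [mul_le_mul_of_nonneg_right hXn hN0.le]
    · have hp2' : (2:ℝ) ≤ p := by exact_mod_cast hp2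
      have h13 : 1 / ((n:ℝ) * N) ≤ 1/3 := by
        apply one_div_le_one_div_of_le (by norm_num); nlinarith
      rw [abs_sub_comm]
      have := le_abs_self ((p:ℝ) - θ)
      linarith
  have hq2' : (2:ℝ) ≤ q := by exact_mod_cast hq2
  obtain ⟨l, hl⟩ : ∃ l : ℝ, l = θ - 1 := ⟨_, rfl⟩
  rw [← hl] at hθ1 hθ2 hθge hPQ
  obtain ⟨δ, hδ⟩ : ∃ δ : ℝ, δ = |θ - (p:ℝ)/q| := ⟨_, rfl⟩
  rw [← hδ]
  have hδ0 : 0 ≤ δ := by rw [hδ]; positivity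
  have hXS1 : 1 ≤ X * S := by nlinarith
  have hgap : ∀ k, 2 * q * l ≤ E ^ k → Q k * (p:ℤ) ≠ P k * (q:ℤ) → 1 ≤ 2 * q * (X * S)^k * δ := by
    intro k hk hne
    obtain ⟨h1, h2, h3, h4, -⟩ := hPQ k
    have hone : (1:ℝ) ≤ |(Q k:ℝ) * p - P k * q| := by
      have : (1:ℤ) ≤ |Q k * (p:ℤ) - P k * (q:ℤ)| := Int.one_le_abs (sub_ne_zero.2 hne)
      exact_mod_cast this
    have e1 : (Q k:ℝ) * p - P k * q = q * (Q k * θ - P k) - Q k * q * (θ - p / q) := by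
      field_simp; ring
    have e2 : |(Q k:ℝ) * p - P k * q| ≤ q * (Q k * θ - P k) + Q k * q * δ := by
      rw [e1]
      refine (abs_sub _ _).trans ?_
      rw [abs_of_pos (by positivity), abs_mul (Q k * q : ℝ), ← hδ, abs_of_pos (by positivity : (0:ℝ) < Q k * q)]
    have e3 : q * (Q k * θ - P k) ≤ 1/2 := by
      have hEk : 0 < E ^ k := by positivity
      have : l * (X/S)^k = l / E^k := by
        rw [hE, div_pow, div_pow]; field_simp
      rw [this] at h4
      calc q * (Q k * θ - P k) ≤ q * (l / E^k) := by gcongr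
        _ ≤ 1/2 := by
          rw [← mul_div_assoc, div_le_iff₀ hEk]; linarith
    have e4 : (Q k:ℝ) * q * δ ≤ (X*S)^k * q * δ := by gcongr
    linarith
  have hgap2 : ∀ k, 2 * q * l ≤ E ^ k → 1 ≤ 2 * q * (X * S)^(k+1) * δ := by
    intro k hk
    by_cases hc : Q k * (p:ℤ) = P k * (q:ℤ)
    · apply hgap (k+1) (hk.trans (pow_le_pow_right₀ hE1.le (by omega)))
      intro hc2
      apply (hPQ k).2.2.2.2
      have hqz : (q:ℤ) ≠ 0 := by exact_mod_cast hq.ne'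
      apply mul_right_cancel₀ hqz
      linear_combination (-Q (k+1)) * hc + Q k * hc2
    · have := hgap k hk hc
      refine this.trans ?_
      gcongr ?_ * ?_ * δ
      exact pow_le_pow_right₀ hXS1 (by omega)
  suffices hfin : ∃ M : ℝ, 1 ≤ M * δ ∧ 0 < M ∧ M < 8 * X * N * (q:ℝ)^lam by
    obtain ⟨M, hM1, hM0, hM2⟩ := hfin
    have hql : 0 < (q:ℝ)^lam := by positivity
    rw [Real.rpow_neg hq0.le, ← mul_inv]
    calc (8 * X * N * (q:ℝ)^lam)⁻¹ < M⁻¹ := by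
          apply inv_strictAnti₀ hM0 hM2
      _ ≤ δ := by
        rw [inv_eq_one_div, div_le_iff₀ hM0]; linarith
  have hqlam : (q:ℝ)^lam = q * (q:ℝ)^τ := by
    rw [hlam', Real.rpow_add hq0, Real.rpow_one]
  have hex : ∃ k, 2 * q * l ≤ E ^ k := by
    obtain ⟨k, hk⟩ := pow_unbounded_of_one_lt (2 * q * l) hE1
    exact ⟨k, hk.le⟩
  classical
  obtain ⟨k, hk, hmin⟩ : ∃ k, 2 * q * l ≤ E ^ k ∧ ∀ m < k, ¬ (2 * q * l ≤ E ^ m) :=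
    ⟨Nat.find hex, Nat.find_spec hex, fun m hm => Nat.find_min hex hm⟩
  refine ⟨2 * q * (X * S)^(k+1), hgap2 k hk, by positivity, ?_⟩
  rw [hqlam]
  rcases Nat.eq_zero_or_pos k with h0 | hkpos
  · subst h0
    have hqτ : (q:ℝ) ≤ (q:ℝ)^τ := by
      conv_lhs => rw [← Real.rpow_one (q:ℝ)]
      exact Real.rpow_le_rpow_of_exponent_le hq1 hτ1.le
    have : 2 * S < 8 * N * (q:ℝ)^τ := by
      have : 8 * (N:ℝ) * 2 ≤ 8 * N * (q:ℝ)^τ := by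
        apply mul_le_mul_of_nonneg_left (by linarith) (by positivity)
      linarith
    have h2 : 0 < X * q := by positivity
    have := mul_lt_mul_of_pos_left this h2
    simp only [zero_add, pow_one]
    linarith
  · have hk1 := hmin (k-1) (by omega)
    rw [not_le] at hk1
    obtain ⟨y, hy⟩ : ∃ y : ℝ, y = 2 * l * E := ⟨_, rfl⟩
    have hy0 : 0 < y := by rw [hy]; positivity
    have hSy : S * y ≤ 4 * N := by
      have : S * y = 2 * l * S^2 / X := by rw [hy, hE]; field_simp
      rw [this, div_le_iff₀ hX0]
      have a1 : S^2 ≤ (4 * N + 2)^2 := by gcongr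
      have a2 : l * (n * N) ≤ 1 := by
        rwa [le_div_iff₀ (by positivity)] at hθ2
      have a3 : S^2 ≤ 2 * n * N^2 * X := by rw [hX]; nlinarith
      calc 2 * l * S^2 ≤ 2 * l * (2 * n * N^2 * X) := by gcongr
        _ = 4 * N * X * (l * (n * N)) := by ring
        _ ≤ 4 * N * X * 1 := by gcongr
        _ = _ := by ring
    have hy1 : y ≤ 1 := by
      by_contra hcon
      rw [not_le] at hcon
      nlinarith
    have hyτ : y ^ τ ≤ y := by
      conv_rhs => rw [← Real.rpow_one y]
      exact Real.rpow_le_rpow_of_exponent_ge hy0 hy1 hτ1.le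
    have hEk : E ^ k < q * y := by
      have : E ^ k = E ^ (k-1) * E := by rw [← pow_succ, Nat.sub_add_cancel hkpos]
      rw [this, hy]
      have := mul_lt_mul_of_pos_right hk1 (show 0 < E by linarith)
      linarith
    have hXSk : (X * S)^k < (q:ℝ)^τ * y := by
      have e1 : (X * S)^k = (E^k)^τ := by
        rw [← hEτ, ← Real.rpow_natCast, ← Real.rpow_natCast, ← Real.rpow_mul (by linarith),
          ← Real.rpow_mul (by linarith), mul_comm]
      rw [e1]
      calc (E^k)^τ < (q * y)^τ := Real.rpow_lt_rpow (by positivity) hEk (by linarith)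
        _ = (q:ℝ)^τ * y^τ := Real.mul_rpow hq0.le hy0.le
        _ ≤ _ := by gcongr
    have hqτ0 : 0 < (q:ℝ)^τ := by positivity
    calc 2 * (q:ℝ) * (X * S)^(k+1) = 2 * q * X * S * (X * S)^k := by rw [pow_succ]; ring
      _ < 2 * q * X * S * ((q:ℝ)^τ * y) := by gcongr
      _ = 2 * q * X * (q:ℝ)^τ * (S * y) := by ring
      _ ≤ 2 * q * X * (q:ℝ)^τ * (4 * N) := by gcongr
      _ = _ := by ring
end
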